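/- arXiv:1908.05173 — 5 statements merged into one kernel-verified Lean document; each statement's English description precedes it below -/
import Mathlib

section
/- Every polynomial f ∈ ℝ[x,y] of total degree 3 satisfies f ∼ g for some polynomial g in the Table (affine classification of cubic curves); moreover, the polynomials listed in the Table are pairwise inequivalent with respect to ∼, i.e., if g₁ and g₂ are distinct polynomials from the Table then g₁ ∼ g₂ fails. -/
open MvPolynomial

/-- The polynomial ring `ℝ[x,y]`, realized as `MvPolynomial (Fin 2) ℝ`
with `X 0 = x` and `X 1 = y`. -/
abbrev P2 : Type := MvPolynomial (Fin 2) ℝ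

/-- `f ∼ g` : there are an affine automorphism `θ ∈ Γ₂(ℝ)` (a ring automorphism
of `ℝ[x,y]` sending `x` and `y` to polynomials of total degree at most 1)
and a nonzero `c ∈ ℝ` with `θ f = c • g`. -/
def AffEquiv (f g : P2) : Prop :=
  ∃ θ : P2 ≃+* P2, (θ (X 0)).totalDegree ≤ 1 ∧ (θ (X 1)).totalDegree ≤ 1 ∧
    ∃ c : ℝ, c ≠ 0 ∧ θ f = C c * g

/-- `f ≈ g` : there are a ring automorphism `φ` of `ℝ[x,y]` and a nonzero
`c ∈ ℝ` with `φ f = c • g`. -/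
def AutEquiv (f g : P2) : Prop :=
  ∃ φ : P2 ≃+* P2, ∃ c : ℝ, c ≠ 0 ∧ φ f = C c * g

/-- The table entries with canonical form `x³ + x·y²`. -/
def FamA (p : P2) : Prop :=
  (∃ H I J : ℝ, 0 ≤ I ∧
    p = X 0 ^ 3 + X 0 * X 1 ^ 2 + X 0 ^ 2 + C H * X 0 + C I * X 1 + C J) ∨
  (∃ H J : ℝ, 0 ≤ J ∧
    p = X 0 ^ 3 + X 0 * X 1 ^ 2 + X 1 + C H * X 0 + C J) ∨
  (∃ e J : ℝ, (e = 1 ∨ e = -1) ∧ 0 ≤ J ∧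
    p = X 0 ^ 3 + X 0 * X 1 ^ 2 + C e * X 0 + C J) ∨
  p = X 0 ^ 3 + X 0 * X 1 ^ 2 + 1 ∨
  p = X 0 ^ 3 + X 0 * X 1 ^ 2

/-- The table entries with canonical form `x³ - x·y²`. -/
def FamB (p : P2) : Prop :=
  (∃ H I J : ℝ, 0 ≤ I ∧ H + I ≤ -(3/4 : ℝ) ∧
    p = X 0 ^ 3 - X 0 * X 1 ^ 2 - X 1 ^ 2 + C H * X 0 + C I * X 1 + C J) ∨
  (∃ H J : ℝ, 0 ≤ J ∧ -1 ≤ H ∧ H ≤ 1 ∧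
    p = X 0 ^ 3 - X 0 * X 1 ^ 2 - X 1 + C H * X 0 + C J) ∨
  p = X 0 ^ 3 - X 0 * X 1 ^ 2 + 1 ∨
  p = X 0 ^ 3 - X 0 * X 1 ^ 2

/-- The table entries with canonical form `x²·y`. -/
def FamC (p : P2) : Prop :=
  (∃ I J : ℝ, p = X 0 ^ 2 * X 1 + X 1 ^ 2 - X 0 + C I * X 1 + C J) ∨
  (∃ e J : ℝ, (e = 1 ∨ e = -1) ∧
    p = X 0 ^ 2 * X 1 + X 1 ^ 2 + C e * X 1 + C J) ∨
  (∃ e : ℝ, (e = 1 ∨ e = -1) ∧ p = X 0 ^ 2 * X 1 + X 1 ^ 2 + C e) ∨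
  p = X 0 ^ 2 * X 1 + X 1 ^ 2 ∨
  (∃ e J : ℝ, (e = 1 ∨ e = -1) ∧ 0 ≤ J ∧
    p = X 0 ^ 2 * X 1 - X 0 + C e * X 1 + C J) ∨
  (∃ e : ℝ, (e = 1 ∨ e = -1) ∧ p = X 0 ^ 2 * X 1 + C e * X 1 + 1) ∨
  (∃ e : ℝ, (e = 1 ∨ e = -1) ∧ p = X 0 ^ 2 * X 1 + C e * X 1) ∨
  p = X 0 ^ 2 * X 1 - X 0 + 1 ∨
  p = X 0 ^ 2 * X 1 - X 0 ∨
  p = X 0 ^ 2 * X 1 - 1 ∨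
  p = X 0 ^ 2 * X 1

/-- The table entries with canonical form `x³`. -/
def FamD (p : P2) : Prop :=
  (∃ e J : ℝ, (e = 1 ∨ e = -1) ∧
    p = X 0 ^ 3 - X 1 ^ 2 + C e * X 0 + C J) ∨
  (∃ e : ℝ, (e = 1 ∨ e = -1) ∧ p = X 0 ^ 3 - X 1 ^ 2 + C e) ∨
  p = X 0 ^ 3 - X 1 ^ 2 ∨
  p = X 0 ^ 3 - X 1 ∨
  p = X 0 ^ 3 - X 0 * X 1 + 1 ∨
  p = X 0 ^ 3 - X 0 * X 1 ∨
  (∃ e J : ℝ, (e = 1 ∨ e = -1) ∧ 0 ≤ J ∧ p = X 0 ^ 3 + C e * X 0 + C J) ∨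
  p = X 0 ^ 3 + 1 ∨
  p = X 0 ^ 3

/-- The full table: the affine/automorphic classification of cubic curves. -/
def InTable (p : P2) : Prop := FamA p ∨ FamB p ∨ FamC p ∨ FamD p


/-- The polynomial of degree at most three with the given coefficients. -/
noncomputable def cubicPoly (a b c d e f g h i j : ℝ) : P2 :=
  C a * X 0 ^ 3 + C b * (X 0 ^ 2 * X 1) + C c * (X 0 * X 1 ^ 2) + C d * X 1 ^ 3
    + C e * X 0 ^ 2 + C f * (X 0 * X 1) + C g * X 1 ^ 2 + C h * X 0 + C i * X 1 + C j

/-- The function `ℝ² → ℝ` given by the polynomial of degree at most three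
with the given coefficients. -/
def cubicFun (a b c d e f g h i j : ℝ) (x y : ℝ) : ℝ :=
  a * x ^ 3 + b * (x ^ 2 * y) + c * (x * y ^ 2) + d * y ^ 3
    + e * x ^ 2 + f * (x * y) + g * y ^ 2 + h * x + i * y + j

lemma eval_cubicPoly (a b c d e f g h i j x y : ℝ) :
    eval ![x, y] (cubicPoly a b c d e f g h i j) = cubicFun a b c d e f g h i j x y := by
  simp [cubicPoly, cubicFun]

lemma P2.ext_eval {f g : P2} (h : ∀ x y : ℝ, eval ![x, y] f = eval ![x, y] g) : f = g := by
  refine MvPolynomial.funext fun v => ?_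
  have hv : v = ![v 0, v 1] := by ext i; fin_cases i <;> rfl
  rw [hv]
  exact h _ _

lemma eq_cubicPoly_of_eval {f : P2} {a b c d e f' g h i j : ℝ}
    (H : ∀ x y : ℝ, eval ![x, y] f = cubicFun a b c d e f' g h i j x y) :
    f = cubicPoly a b c d e f' g h i j :=
  P2.ext_eval fun x y => by rw [H, eval_cubicPoly]

/-- Polynomials of total degree at most `n` have an additive property as soon as
the monomials of degree at most `n` have it. -/
lemma P2.induction_totalDegree {n : ℕ} {p : P2 → Prop} (h0 : p 0)
    (hadd : ∀ f g, p f → p g → p (f + g))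
    (hmon : ∀ (k l : ℕ) (r : ℝ), k + l ≤ n → p (C r * X 0 ^ k * X 1 ^ l))
    {f : P2} (hf : f.totalDegree ≤ n) : p f := by
  rw [f.as_sum]
  refine Finset.sum_induction _ p hadd h0 fun m hm => ?_
  have hdeg : m 0 + m 1 ≤ n := by
    have := (le_totalDegree hm).trans hf
    rwa [Finsupp.sum_fintype _ _ (fun _ => rfl), Fin.sum_univ_two] at this
  have := hmon (m 0) (m 1) (coeff m f) hdeg
  rwa [monomial_eq, Finsupp.prod_fintype _ _ (fun _ => pow_zero _), Fin.prod_univ_two, ← mul_assoc]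

lemma exists_eq_cubicPoly {f : P2} (hf : f.totalDegree ≤ 3) :
    ∃ a b c d e f' g h i j : ℝ, f = cubicPoly a b c d e f' g h i j := by
  refine P2.induction_totalDegree (p := fun f => ∃ a b c d e f' g h i j : ℝ,
    f = cubicPoly a b c d e f' g h i j) ?_ ?_ ?_ hf
  · exact ⟨0, 0, 0, 0, 0, 0, 0, 0, 0, 0, by simp [cubicPoly]⟩
  · rintro _ _ ⟨a, b, c, d, e, f, g, h, i, j, rfl⟩ ⟨a', b', c', d', e', f', g', h', i', j', rfl⟩
    exact ⟨a + a', b + b', c + c', d + d', e + e', f + f', g + g', h + h', i + i', j + j', by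
      simp only [cubicPoly, C_add]; ring⟩
  · intro k l r hkl
    have hk : k ≤ 3 := by omega
    have hl : l ≤ 3 := by omega
    interval_cases k <;> interval_cases l <;> first | omega | skip
    · exact ⟨0, 0, 0, 0, 0, 0, 0, 0, 0, r, by simp [cubicPoly]⟩
    · exact ⟨0, 0, 0, 0, 0, 0, 0, 0, r, 0, by simp [cubicPoly]⟩
    · exact ⟨0, 0, 0, 0, 0, 0, r, 0, 0, 0, by simp [cubicPoly]⟩
    · exact ⟨0, 0, 0, r, 0, 0, 0, 0, 0, 0, by simp [cubicPoly]⟩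
    · exact ⟨0, 0, 0, 0, 0, 0, 0, r, 0, 0, by simp [cubicPoly]⟩
    · exact ⟨0, 0, 0, 0, 0, r, 0, 0, 0, 0, by simp [cubicPoly, mul_assoc]⟩
    · exact ⟨0, 0, r, 0, 0, 0, 0, 0, 0, 0, by simp [cubicPoly, mul_assoc]⟩
    · exact ⟨0, 0, 0, 0, r, 0, 0, 0, 0, 0, by simp [cubicPoly]⟩
    · exact ⟨0, r, 0, 0, 0, 0, 0, 0, 0, 0, by simp [cubicPoly, mul_assoc]⟩
    · exact ⟨r, 0, 0, 0, 0, 0, 0, 0, 0, 0, by simp [cubicPoly]⟩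

lemma exists_eq_affine {f : P2} (hf : f.totalDegree ≤ 1) :
    ∃ p q r : ℝ, f = C p * X 0 + C q * X 1 + C r := by
  refine P2.induction_totalDegree (p := fun f => ∃ p q r : ℝ,
    f = C p * X 0 + C q * X 1 + C r) ?_ ?_ ?_ hf
  · exact ⟨0, 0, 0, by simp⟩
  · rintro _ _ ⟨p, q, r, rfl⟩ ⟨p', q', r', rfl⟩
    exact ⟨p + p', q + q', r + r', by simp only [C_add]; ring⟩
  · intro k l r hkl
    have hk : k ≤ 1 := by omega
    have hl : l ≤ 1 := by omega
    interval_cases k <;> interval_cases l <;> first | omega | skip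
    · exact ⟨0, 0, r, by simp⟩
    · exact ⟨0, r, 0, by simp⟩
    · exact ⟨r, 0, 0, by simp⟩

lemma totalDegree_C_mul_X_pow_le (r : ℝ) (k l : ℕ) :
    (C r * (X 0 ^ k * X 1 ^ l) : P2).totalDegree ≤ k + l := by
  refine (totalDegree_mul _ _).trans ?_
  rw [totalDegree_C, zero_add]
  refine (totalDegree_mul _ _).trans ?_
  rw [totalDegree_X_pow, totalDegree_X_pow]

lemma totalDegree_affine_le (p q r : ℝ) :
    (C p * X 0 + C q * X 1 + C r : P2).totalDegree ≤ 1 := by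
  have h1 := totalDegree_C_mul_X_pow_le p 1 0
  have h2 := totalDegree_C_mul_X_pow_le q 0 1
  simp only [pow_one, pow_zero, mul_one, one_mul, add_zero, zero_add] at h1 h2
  refine (totalDegree_add _ _).trans (max_le ((totalDegree_add _ _).trans (max_le h1 h2)) ?_)
  simp

lemma cubicPoly_totalDegree_le_two (e f g h i j : ℝ) :
    (cubicPoly 0 0 0 0 e f g h i j).totalDegree ≤ 2 := by
  have h1 := totalDegree_C_mul_X_pow_le e 2 0
  have h2 := totalDegree_C_mul_X_pow_le f 1 1
  have h3 := totalDegree_C_mul_X_pow_le g 0 2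
  have h4 := (totalDegree_affine_le h i j).trans one_le_two
  simp only [pow_one, pow_zero, mul_one, one_mul, add_zero, zero_add] at h1 h2 h3
  have : cubicPoly 0 0 0 0 e f g h i j =
      C e * X 0 ^ 2 + C f * (X 0 * X 1) + C g * X 1 ^ 2 + (C h * X 0 + C i * X 1 + C j) := by
    simp only [cubicPoly, C_0]; ring
  rw [this]
  exact (totalDegree_add _ _).trans (max_le ((totalDegree_add _ _).trans
    (max_le ((totalDegree_add _ _).trans (max_le h1 h2)) h3)) h4)

/-- Two functions on `ℝ²` agree up to an invertible affine change of variables and a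
nonzero factor. -/
def FunEquiv (F G : ℝ → ℝ → ℝ) : Prop :=
  ∃ p q r s t u c : ℝ, p * t - q * s ≠ 0 ∧ c ≠ 0 ∧
    ∀ x y, F (p * x + q * y + r) (s * x + t * y + u) = c * G x y

lemma FunEquiv.trans {F G K : ℝ → ℝ → ℝ} (h₁ : FunEquiv F G) (h₂ : FunEquiv G K) :
    FunEquiv F K := by
  obtain ⟨p, q, r, s, t, u, c, hd, hc, h⟩ := h₁
  obtain ⟨p', q', r', s', t', u', c', hd', hc', h'⟩ := h₂
  refine ⟨p * p' + q * s', p * q' + q * t', p * r' + q * u' + r,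
    s * p' + t * s', s * q' + t * t', s * r' + t * u' + u, c * c', ?_, mul_ne_zero hc hc', ?_⟩
  · convert mul_ne_zero hd hd' using 1
    ring
  · intro x y
    rw [mul_assoc, ← h', ← h]
    congr 1 <;> ring

lemma P2.ringEquiv_C (θ : P2 ≃+* P2) (r : ℝ) : θ (C r) = C r := by
  have hid : (constantCoeff.comp (θ : P2 →+* P2)).comp C = RingHom.id ℝ := Subsingleton.elim _ _
  have hr : constantCoeff (θ (C r)) = r := RingHom.congr_fun hid r
  rcases eq_or_ne r 0 with rfl | h
  · simp
  · have hu : IsUnit (θ (C r)) := ((isUnit_iff_ne_zero.mpr h).map C).map θ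
    obtain ⟨s, -, hs⟩ := isUnit_iff_eq_C_of_isReduced.mp hu
    rw [hs, constantCoeff_C] at hr
    rw [hs, hr]

lemma P2.ringEquiv_eval (θ : P2 ≃+* P2) (f : P2) (v : Fin 2 → ℝ) :
    eval v (θ f) = eval ![eval v (θ (X 0)), eval v (θ (X 1))] f := by
  have : (eval v).comp (θ : P2 →+* P2) = eval ![eval v (θ (X 0)), eval v (θ (X 1))] := by
    refine ringHom_ext (fun r => ?_) (fun i => ?_)
    · simp [P2.ringEquiv_C]
    · fin_cases i <;> simp
  exact congrArg (fun φ => φ f) this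

lemma P2.ringEquiv_det_ne_zero {θ : P2 ≃+* P2} {p q r s t u : ℝ}
    (h0 : θ (X 0) = C p * X 0 + C q * X 1 + C r)
    (h1 : θ (X 1) = C s * X 0 + C t * X 1 + C u) : p * t - q * s ≠ 0 := by
  intro hd
  have key : ∀ m n : ℝ, m * p + n * s = 0 → m * q + n * t = 0 → m = 0 ∧ n = 0 := by
    intro m n e1 e2
    have hθ : θ (C m * X 0 + C n * X 1) = θ (C (m * r + n * u)) := by
      rw [map_add, map_mul, map_mul, P2.ringEquiv_C, P2.ringEquiv_C, P2.ringEquiv_C, h0, h1]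
      refine P2.ext_eval fun x y => ?_
      simp
      linear_combination x * e1 + y * e2
    have h := θ.injective hθ
    have h00 := congrArg (eval ![0, 0]) h
    have h10 := congrArg (eval ![1, 0]) h
    have h01 := congrArg (eval ![0, 1]) h
    simp at h00 h10 h01
    constructor <;> linarith
  have k1 := key t (-q) (by linear_combination hd) (by ring)
  have k2 := key s (-p) (by ring) (by linear_combination -hd)
  have hp : p = 0 := by linarith [k2.2]
  have k3 := key 1 0 (by simp [hp]) (by linarith [k1.2])
  exact one_ne_zero k3.1

lemma AffEquiv.funEquiv {f g : P2} (h : AffEquiv f g) :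
    FunEquiv (fun x y => eval ![x, y] f) (fun x y => eval ![x, y] g) := by
  obtain ⟨θ, h0, h1, c, hc, h⟩ := h
  obtain ⟨p, q, r, h0⟩ := exists_eq_affine h0
  obtain ⟨s, t, u, h1⟩ := exists_eq_affine h1
  refine ⟨p, q, r, s, t, u, c, P2.ringEquiv_det_ne_zero h0 h1, hc, fun x y => ?_⟩
  have := P2.ringEquiv_eval θ f ![x, y]
  rw [h, h0, h1] at this
  simpa using this.symm

lemma FunEquiv.affEquiv {f g : P2}
    (h : FunEquiv (fun x y => eval ![x, y] f) (fun x y => eval ![x, y] g)) : AffEquiv f g := by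
  obtain ⟨p, q, r, s, t, u, c, hd, hc, h⟩ := h
  let A : P2 →ₐ[ℝ] P2 := aeval ![C p * X 0 + C q * X 1 + C r, C s * X 0 + C t * X 1 + C u]
  let D := p * t - q * s
  let B : P2 →ₐ[ℝ] P2 := aeval
    ![C (t / D) * X 0 + C (-q / D) * X 1 + C ((q * u - t * r) / D),
      C (-s / D) * X 0 + C (p / D) * X 1 + C ((s * r - p * u) / D)]
  have hD : D ≠ 0 := hd
  have hAB : A.comp B = AlgHom.id ℝ P2 := by
    refine algHom_ext fun i => P2.ext_eval fun x y => ?_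
    fin_cases i <;> simp [A, B, algHom_C] <;> field_simp <;>
      simp only [D] <;> ring
  have hBA : B.comp A = AlgHom.id ℝ P2 := by
    refine algHom_ext fun i => P2.ext_eval fun x y => ?_
    fin_cases i <;> simp [A, B, algHom_C] <;> field_simp <;>
      simp only [D] <;> ring
  let θ : P2 ≃+* P2 := (AlgEquiv.ofAlgHom A B hAB hBA).toRingEquiv
  have h0 : θ (X 0) = C p * X 0 + C q * X 1 + C r := by simp [θ, A]
  have h1 : θ (X 1) = C s * X 0 + C t * X 1 + C u := by simp [θ, A]
  refine ⟨θ, ?_, ?_, c, hc, P2.ext_eval fun x y => ?_⟩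
  · rw [h0]; exact totalDegree_affine_le p q r
  · rw [h1]; exact totalDegree_affine_le s t u
  · rw [P2.ringEquiv_eval, h0, h1]
    simpa using h x y

lemma affEquiv_iff_funEquiv {f g : P2} : AffEquiv f g ↔
    FunEquiv (fun x y => eval ![x, y] f) (fun x y => eval ![x, y] g) :=
  ⟨AffEquiv.funEquiv, FunEquiv.affEquiv⟩

lemma affEquiv_cubicPoly_iff {a b c d e f g h i j a' b' c' d' e' f' g' h' i' j' : ℝ} :
    AffEquiv (cubicPoly a b c d e f g h i j) (cubicPoly a' b' c' d' e' f' g' h' i' j') ↔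
      FunEquiv (cubicFun a b c d e f g h i j) (cubicFun a' b' c' d' e' f' g' h' i' j') := by
  simp only [affEquiv_iff_funEquiv, eval_cubicPoly]

lemma cubicFun_inj {a b c d e f g h i j a' b' c' d' e' f' g' h' i' j' : ℝ}
    (H : ∀ x y, cubicFun a b c d e f g h i j x y = cubicFun a' b' c' d' e' f' g' h' i' j' x y) :
    (a = a' ∧ b = b' ∧ c = c' ∧ d = d') ∧ (e = e' ∧ f = f' ∧ g = g') ∧
      h = h' ∧ i = i' ∧ j = j' := by
  have h1 := H 0 0
  have h2 := H 1 0
  have h3 := H (-1) 0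
  have h4 := H 2 0
  have h5 := H 0 1
  have h6 := H 0 (-1)
  have h7 := H 0 2
  have h8 := H 1 1
  have h9 := H 1 (-1)
  have h10 := H (-1) 1
  simp only [cubicFun] at h1 h2 h3 h4 h5 h6 h7 h8 h9 h10
  refine ⟨⟨?_, ?_, ?_, ?_⟩, ⟨?_, ?_, ?_⟩, ?_, ?_, ?_⟩ <;> linarith

/-- The coefficients of a cubic after an affine change of variables. -/
lemma FunEquiv.coeff_eq {a b c d e f g h i j a' b' c' d' e' f' g' h' i' j' : ℝ}
    (H : FunEquiv (cubicFun a b c d e f g h i j) (cubicFun a' b' c' d' e' f' g' h' i' j')) :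
    ∃ p q r s t u k : ℝ, p * t - q * s ≠ 0 ∧ k ≠ 0 ∧
      (a * p ^ 3 + b * (p ^ 2 * s) + c * (p * s ^ 2) + d * s ^ 3 = k * a' ∧
      3 * a * p ^ 2 * q + b * (p ^ 2 * t + 2 * p * q * s) + c * (2 * p * s * t + q * s ^ 2)
        + 3 * d * s ^ 2 * t = k * b' ∧
      3 * a * p * q ^ 2 + b * (q ^ 2 * s + 2 * p * q * t) + c * (p * t ^ 2 + 2 * q * s * t)
        + 3 * d * s * t ^ 2 = k * c' ∧
      a * q ^ 3 + b * (q ^ 2 * t) + c * (q * t ^ 2) + d * t ^ 3 = k * d') ∧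
      (3 * a * p ^ 2 * r + b * (p ^ 2 * u + 2 * p * r * s) + c * (2 * p * s * u + r * s ^ 2)
        + 3 * d * s ^ 2 * u + e * p ^ 2 + f * (p * s) + g * s ^ 2 = k * e' ∧
      6 * a * p * q * r + b * (2 * p * q * u + 2 * r * (p * t + q * s))
        + c * (2 * u * (p * t + q * s) + 2 * r * s * t) + 6 * d * s * t * u
        + 2 * e * p * q + f * (p * t + q * s) + 2 * g * s * t = k * f' ∧
      3 * a * q ^ 2 * r + b * (q ^ 2 * u + 2 * q * r * t) + c * (2 * q * t * u + r * t ^ 2)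
        + 3 * d * t ^ 2 * u + e * q ^ 2 + f * (q * t) + g * t ^ 2 = k * g') ∧
      3 * a * p * r ^ 2 + b * (2 * p * r * u + r ^ 2 * s) + c * (p * u ^ 2 + 2 * r * s * u)
        + 3 * d * s * u ^ 2 + 2 * e * p * r + f * (p * u + r * s) + 2 * g * s * u
        + h * p + i * s = k * h' ∧
      3 * a * q * r ^ 2 + b * (2 * q * r * u + r ^ 2 * t) + c * (q * u ^ 2 + 2 * r * t * u)
        + 3 * d * t * u ^ 2 + 2 * e * q * r + f * (q * u + r * t) + 2 * g * t * u
        + h * q + i * t = k * i' ∧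
      a * r ^ 3 + b * (r ^ 2 * u) + c * (r * u ^ 2) + d * u ^ 3
        + e * r ^ 2 + f * (r * u) + g * u ^ 2 + h * r + i * u + j = k * j' := by
  obtain ⟨p, q, r, s, t, u, k, hd, hk, H⟩ := H
  refine ⟨p, q, r, s, t, u, k, hd, hk, cubicFun_inj fun x y => ?_⟩
  have := H x y
  simp only [cubicFun] at this ⊢
  linear_combination this

/-- The parameters of the table entries `x³ + x·y² + k·x² + H·x + I·y + J`. -/
def NormalA (k H I J : ℝ) : Prop :=
  (k = 1 ∧ 0 ≤ I) ∨ (k = 0 ∧ I = 1 ∧ 0 ≤ J) ∨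
  (k = 0 ∧ I = 0 ∧ (H = 1 ∨ H = -1) ∧ 0 ≤ J) ∨ (k = 0 ∧ I = 0 ∧ H = 0 ∧ (J = 1 ∨ J = 0))

/-- The parameters of the table entries `x³ - x·y² - k·y² + H·x + I·y + J`. -/
def NormalB (k H I J : ℝ) : Prop :=
  (k = 1 ∧ 0 ≤ I ∧ H + I ≤ -(3/4 : ℝ)) ∨ (k = 0 ∧ I = -1 ∧ 0 ≤ J ∧ -1 ≤ H ∧ H ≤ 1) ∨
  (k = 0 ∧ I = 0 ∧ H = 0 ∧ (J = 1 ∨ J = 0))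

/-- The parameters of the table entries `x²·y + k·y² + H·x + I·y + J`. -/
def NormalC (k H I J : ℝ) : Prop :=
  (k = 1 ∧ H = -1) ∨ (k = 1 ∧ H = 0 ∧ (I = 1 ∨ I = -1)) ∨
  (k = 1 ∧ H = 0 ∧ I = 0 ∧ ((J = 1 ∨ J = -1) ∨ J = 0)) ∨
  (k = 0 ∧ H = -1 ∧ (I = 1 ∨ I = -1) ∧ 0 ≤ J) ∨
  (k = 0 ∧ H = 0 ∧ (I = 1 ∨ I = -1) ∧ (J = 1 ∨ J = 0)) ∨
  (k = 0 ∧ H = -1 ∧ I = 0 ∧ (J = 1 ∨ J = 0)) ∨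
  (k = 0 ∧ H = 0 ∧ I = 0 ∧ (J = -1 ∨ J = 0))

/-- The parameters of the table entries `x³ + m·x·y + n·y² + H·x + I·y + J`. -/
def NormalD (m n H I J : ℝ) : Prop :=
  (m = 0 ∧ n = -1 ∧ I = 0 ∧ (H = 1 ∨ H = -1)) ∨
  (m = 0 ∧ n = -1 ∧ I = 0 ∧ H = 0 ∧ ((J = 1 ∨ J = -1) ∨ J = 0)) ∨
  (m = 0 ∧ n = 0 ∧ I = -1 ∧ H = 0 ∧ J = 0) ∨
  (m = -1 ∧ n = 0 ∧ I = 0 ∧ H = 0 ∧ (J = 1 ∨ J = 0)) ∨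
  (m = 0 ∧ n = 0 ∧ I = 0 ∧ (H = 1 ∨ H = -1) ∧ 0 ≤ J) ∨
  (m = 0 ∧ n = 0 ∧ I = 0 ∧ H = 0 ∧ (J = 1 ∨ J = 0))

lemma famA_iff {p : P2} :
    FamA p ↔ ∃ k H I J, NormalA k H I J ∧ p = cubicPoly 1 0 1 0 k 0 0 H I J := by
  constructor
  · rintro (⟨H, I, J, hI, rfl⟩ | ⟨H, J, hJ, rfl⟩ | ⟨e, J, he, hJ, rfl⟩ | rfl | rfl)
    · exact ⟨1, H, I, J, Or.inl ⟨rfl, hI⟩, eq_cubicPoly_of_eval fun x y => by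
        simp [cubicFun]⟩
    · exact ⟨0, H, 1, J, Or.inr (Or.inl ⟨rfl, rfl, hJ⟩), eq_cubicPoly_of_eval fun x y => by
        simp [cubicFun]; ring⟩
    · exact ⟨0, e, 0, J, by simp [NormalA, he, hJ], eq_cubicPoly_of_eval fun x y => by
        simp [cubicFun]⟩
    · exact ⟨0, 0, 0, 1, by simp [NormalA], eq_cubicPoly_of_eval fun x y => by simp [cubicFun]⟩
    · exact ⟨0, 0, 0, 0, by simp [NormalA], eq_cubicPoly_of_eval fun x y => by simp [cubicFun]⟩
  · rintro ⟨k, H, I, J, ⟨rfl, hI⟩ | ⟨rfl, rfl, hJ⟩ | ⟨rfl, rfl, he, hJ⟩ | ⟨rfl, rfl, rfl, rfl | rfl⟩,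
      rfl⟩
    · exact Or.inl ⟨H, I, J, hI, by simp [cubicPoly]⟩
    · exact Or.inr (Or.inl ⟨H, J, hJ, by simp [cubicPoly]; ring⟩)
    · exact Or.inr (Or.inr (Or.inl ⟨H, J, he, hJ, by simp [cubicPoly]⟩))
    · exact Or.inr (Or.inr (Or.inr (Or.inl (by simp [cubicPoly]))))
    · exact Or.inr (Or.inr (Or.inr (Or.inr (by simp [cubicPoly]))))

lemma famB_iff {p : P2} :
    FamB p ↔ ∃ k H I J, NormalB k H I J ∧ p = cubicPoly 1 0 (-1) 0 0 0 (-k) H I J := by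
  constructor
  · rintro (⟨H, I, J, hI, hHI, rfl⟩ | ⟨H, J, hJ, h1, h2, rfl⟩ | rfl | rfl)
    · exact ⟨1, H, I, J, Or.inl ⟨rfl, hI, hHI⟩, eq_cubicPoly_of_eval fun x y => by
        simp [cubicFun]; ring⟩
    · exact ⟨0, H, -1, J, Or.inr (Or.inl ⟨rfl, rfl, hJ, h1, h2⟩), eq_cubicPoly_of_eval fun x y => by
        simp [cubicFun]; ring⟩
    · exact ⟨0, 0, 0, 1, by simp [NormalB], eq_cubicPoly_of_eval fun x y => by
        simp [cubicFun]; ring⟩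
    · exact ⟨0, 0, 0, 0, by simp [NormalB], eq_cubicPoly_of_eval fun x y => by
        simp [cubicFun]; ring⟩
  · rintro ⟨k, H, I, J, ⟨rfl, hI, hHI⟩ | ⟨rfl, rfl, hJ, h1, h2⟩ | ⟨rfl, rfl, rfl, rfl | rfl⟩, rfl⟩
    · exact Or.inl ⟨H, I, J, hI, hHI, by simp [cubicPoly]; ring⟩
    · exact Or.inr (Or.inl ⟨H, J, hJ, h1, h2, by simp [cubicPoly]; ring⟩)
    · exact Or.inr (Or.inr (Or.inl (by simp [cubicPoly]; ring)))
    · exact Or.inr (Or.inr (Or.inr (by simp [cubicPoly]; ring)))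

lemma famC_iff {p : P2} :
    FamC p ↔ ∃ k H I J, NormalC k H I J ∧ p = cubicPoly 0 1 0 0 0 0 k H I J := by
  constructor
  · rintro (⟨I, J, rfl⟩ | ⟨e, J, he, rfl⟩ | ⟨e, he, rfl⟩ | rfl | ⟨e, J, he, hJ, rfl⟩ |
      ⟨e, he, rfl⟩ | ⟨e, he, rfl⟩ | rfl | rfl | rfl | rfl)
    · exact ⟨1, -1, I, J, by simp [NormalC], eq_cubicPoly_of_eval fun x y => by
        simp [cubicFun]; ring⟩
    · exact ⟨1, 0, e, J, by simp [NormalC, he], eq_cubicPoly_of_eval fun x y => by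
        simp [cubicFun]⟩
    · exact ⟨1, 0, 0, e, by simp [NormalC, he], eq_cubicPoly_of_eval fun x y => by
        simp [cubicFun]⟩
    · exact ⟨1, 0, 0, 0, by simp [NormalC], eq_cubicPoly_of_eval fun x y => by
        simp [cubicFun]⟩
    · exact ⟨0, -1, e, J, by simp [NormalC, he, hJ], eq_cubicPoly_of_eval fun x y => by
        simp [cubicFun]; ring⟩
    · exact ⟨0, 0, e, 1, by simp [NormalC, he], eq_cubicPoly_of_eval fun x y => by
        simp [cubicFun]⟩
    · exact ⟨0, 0, e, 0, by simp [NormalC, he], eq_cubicPoly_of_eval fun x y => by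
        simp [cubicFun]⟩
    · exact ⟨0, -1, 0, 1, by simp [NormalC], eq_cubicPoly_of_eval fun x y => by
        simp [cubicFun]; ring⟩
    · exact ⟨0, -1, 0, 0, by simp [NormalC], eq_cubicPoly_of_eval fun x y => by
        simp [cubicFun]; ring⟩
    · exact ⟨0, 0, 0, -1, by simp [NormalC], eq_cubicPoly_of_eval fun x y => by
        simp [cubicFun]; ring⟩
    · exact ⟨0, 0, 0, 0, by simp [NormalC], eq_cubicPoly_of_eval fun x y => by
        simp [cubicFun]⟩
  · rintro ⟨k, H, I, J, ⟨rfl, rfl⟩ | ⟨rfl, rfl, he⟩ | ⟨rfl, rfl, rfl, he | rfl⟩ |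
      ⟨rfl, rfl, he, hJ⟩ | ⟨rfl, rfl, he, rfl | rfl⟩ | ⟨rfl, rfl, rfl, rfl | rfl⟩ |
      ⟨rfl, rfl, rfl, rfl | rfl⟩, rfl⟩
    · exact Or.inl ⟨I, J, by simp [cubicPoly]; ring⟩
    · exact Or.inr (Or.inl ⟨I, J, he, by simp [cubicPoly]⟩)
    · exact Or.inr (Or.inr (Or.inl ⟨J, he, by simp [cubicPoly]⟩))
    · exact Or.inr (Or.inr (Or.inr (Or.inl (by simp [cubicPoly]))))
    · exact Or.inr (Or.inr (Or.inr (Or.inr (Or.inl ⟨I, J, he, hJ, by simp [cubicPoly]; ring⟩))))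
    · exact Or.inr (Or.inr (Or.inr (Or.inr (Or.inr (Or.inl ⟨I, he, by simp [cubicPoly]⟩)))))
    · exact Or.inr (Or.inr (Or.inr (Or.inr (Or.inr (Or.inr (Or.inl
        ⟨I, he, by simp [cubicPoly]⟩))))))
    · exact Or.inr (Or.inr (Or.inr (Or.inr (Or.inr (Or.inr (Or.inr (Or.inl
        (by simp [cubicPoly]; ring))))))))
    · exact Or.inr (Or.inr (Or.inr (Or.inr (Or.inr (Or.inr (Or.inr (Or.inr (Or.inl
        (by simp [cubicPoly]; ring)))))))))
    · exact Or.inr (Or.inr (Or.inr (Or.inr (Or.inr (Or.inr (Or.inr (Or.inr (Or.inr (Or.inl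
        (by simp [cubicPoly]; ring))))))))))
    · exact Or.inr (Or.inr (Or.inr (Or.inr (Or.inr (Or.inr (Or.inr (Or.inr (Or.inr (Or.inr
        (by simp [cubicPoly]))))))))))

lemma famD_iff {p : P2} :
    FamD p ↔ ∃ m n H I J, NormalD m n H I J ∧ p = cubicPoly 1 0 0 0 0 m n H I J := by
  constructor
  · rintro (⟨e, J, he, rfl⟩ | ⟨e, he, rfl⟩ | rfl | rfl | rfl | rfl | ⟨e, J, he, hJ, rfl⟩ | rfl |
      rfl)
    · exact ⟨0, -1, e, 0, J, by simp [NormalD, he], eq_cubicPoly_of_eval fun x y => by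
        simp [cubicFun]; ring⟩
    · exact ⟨0, -1, 0, 0, e, by simp [NormalD, he], eq_cubicPoly_of_eval fun x y => by
        simp [cubicFun]; ring⟩
    · exact ⟨0, -1, 0, 0, 0, by simp [NormalD], eq_cubicPoly_of_eval fun x y => by
        simp [cubicFun]; ring⟩
    · exact ⟨0, 0, 0, -1, 0, by simp [NormalD], eq_cubicPoly_of_eval fun x y => by
        simp [cubicFun]; ring⟩
    · exact ⟨-1, 0, 0, 0, 1, by simp [NormalD], eq_cubicPoly_of_eval fun x y => by
        simp [cubicFun]; ring⟩
    · exact ⟨-1, 0, 0, 0, 0, by simp [NormalD], eq_cubicPoly_of_eval fun x y => by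
        simp [cubicFun]; ring⟩
    · exact ⟨0, 0, e, 0, J, by simp [NormalD, he, hJ], eq_cubicPoly_of_eval fun x y => by
        simp [cubicFun]⟩
    · exact ⟨0, 0, 0, 0, 1, by simp [NormalD], eq_cubicPoly_of_eval fun x y => by
        simp [cubicFun]⟩
    · exact ⟨0, 0, 0, 0, 0, by simp [NormalD], eq_cubicPoly_of_eval fun x y => by
        simp [cubicFun]⟩
  · rintro ⟨m, n, H, I, J, ⟨rfl, rfl, rfl, he⟩ | ⟨rfl, rfl, rfl, rfl, he | rfl⟩ |
      ⟨rfl, rfl, rfl, rfl, rfl⟩ | ⟨rfl, rfl, rfl, rfl, rfl | rfl⟩ | ⟨rfl, rfl, rfl, he, hJ⟩ |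
      ⟨rfl, rfl, rfl, rfl, rfl | rfl⟩, rfl⟩
    · exact Or.inl ⟨H, J, he, by simp [cubicPoly]; ring⟩
    · exact Or.inr (Or.inl ⟨J, he, by simp [cubicPoly]; ring⟩)
    · exact Or.inr (Or.inr (Or.inl (by simp [cubicPoly]; ring)))
    · exact Or.inr (Or.inr (Or.inr (Or.inl (by simp [cubicPoly]; ring))))
    · exact Or.inr (Or.inr (Or.inr (Or.inr (Or.inl (by simp [cubicPoly]; ring)))))
    · exact Or.inr (Or.inr (Or.inr (Or.inr (Or.inr (Or.inl (by simp [cubicPoly]; ring))))))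
    · exact Or.inr (Or.inr (Or.inr (Or.inr (Or.inr (Or.inr (Or.inl
        ⟨H, J, he, hJ, by simp [cubicPoly]⟩))))))
    · exact Or.inr (Or.inr (Or.inr (Or.inr (Or.inr (Or.inr (Or.inr (Or.inl
        (by simp [cubicPoly]))))))))
    · exact Or.inr (Or.inr (Or.inr (Or.inr (Or.inr (Or.inr (Or.inr (Or.inr
        (by simp [cubicPoly]))))))))

/-- A function on `ℝ²` is classified if it is affinely equivalent to a table entry. -/
def Classified (F : ℝ → ℝ → ℝ) : Prop :=
  ∃ g : P2, InTable g ∧ FunEquiv F (fun x y => eval ![x, y] g)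

lemma Classified.of_funEquiv {F G : ℝ → ℝ → ℝ} (h : FunEquiv F G) : Classified G → Classified F :=
  fun ⟨g, hg, hG⟩ => ⟨g, hg, h.trans hG⟩

lemma classified_normalA {k H I J : ℝ} (h : NormalA k H I J) :
    Classified (cubicFun 1 0 1 0 k 0 0 H I J) :=
  ⟨_, Or.inl (famA_iff.mpr ⟨k, H, I, J, h, rfl⟩), 1, 0, 0, 0, 1, 0, 1, by simp, by simp,
    fun x y => by simp only [eval_cubicPoly]; simp⟩

lemma classified_normalB {k H I J : ℝ} (h : NormalB k H I J) :
    Classified (cubicFun 1 0 (-1) 0 0 0 (-k) H I J) :=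
  ⟨_, Or.inr (Or.inl (famB_iff.mpr ⟨k, H, I, J, h, rfl⟩)), 1, 0, 0, 0, 1, 0, 1, by simp, by simp,
    fun x y => by simp only [eval_cubicPoly]; simp⟩

lemma classified_normalC {k H I J : ℝ} (h : NormalC k H I J) :
    Classified (cubicFun 0 1 0 0 0 0 k H I J) :=
  ⟨_, Or.inr (Or.inr (Or.inl (famC_iff.mpr ⟨k, H, I, J, h, rfl⟩))), 1, 0, 0, 0, 1, 0, 1,
    by simp, by simp, fun x y => by simp only [eval_cubicPoly]; simp⟩

lemma classified_normalD {m n H I J : ℝ} (h : NormalD m n H I J) :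
    Classified (cubicFun 1 0 0 0 0 m n H I J) :=
  ⟨_, Or.inr (Or.inr (Or.inr (famD_iff.mpr ⟨m, n, H, I, J, h, rfl⟩))), 1, 0, 0, 0, 1, 0, 1,
    by simp, by simp, fun x y => by simp only [eval_cubicPoly]; simp⟩

lemma exists_cube_root {z : ℝ} (hz : z ≠ 0) : ∃ a : ℝ, a ≠ 0 ∧ z = a ^ 3 := by
  obtain ⟨b, hb⟩ : ∃ b : ℝ, b ^ 3 = |z| :=
    ⟨|z| ^ ((3 : ℕ) : ℝ)⁻¹, Real.rpow_inv_natCast_pow (abs_nonneg z) (by norm_num)⟩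
  obtain ⟨a, rfl⟩ : ∃ a : ℝ, z = a ^ 3 := by
    rcases abs_cases z with ⟨h, -⟩ | ⟨h, -⟩
    · exact ⟨b, by rw [hb, h]⟩
    · exact ⟨-b, by rw [Odd.neg_pow (by decide), hb, h, neg_neg]⟩
  exact ⟨a, by rintro rfl; simp at hz, rfl⟩

lemma exists_sign_mul_sq {z : ℝ} (hz : z ≠ 0) (J : ℝ) :
    ∃ a e : ℝ, a ≠ 0 ∧ (e = 1 ∨ e = -1) ∧ z = e * a ^ 2 ∧ 0 ≤ J / a ^ 3 := by
  have hs : 0 < √|z| := Real.sqrt_pos.mpr (abs_pos.mpr hz)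
  have hsq : √|z| ^ 2 = |z| := Real.sq_sqrt (abs_nonneg z)
  obtain ⟨e, he, hez⟩ : ∃ e : ℝ, (e = 1 ∨ e = -1) ∧ z = e * |z| := by
    rcases abs_cases z with ⟨h, -⟩ | ⟨h, -⟩
    · exact ⟨1, Or.inl rfl, by rw [h, one_mul]⟩
    · exact ⟨-1, Or.inr rfl, by rw [h]; ring⟩
  rcases le_total 0 J with hJ | hJ
  · exact ⟨√|z|, e, hs.ne', he, by rw [hsq]; exact hez, by positivity⟩
  · refine ⟨-√|z|, e, neg_ne_zero.mpr hs.ne', he, by rw [neg_sq, hsq]; exact hez, ?_⟩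
    rw [Odd.neg_pow (by decide), div_neg, ← neg_div]
    exact div_nonneg (by linarith) (by positivity)

lemma exists_sign_mul_pow_four {z : ℝ} (hz : z ≠ 0) :
    ∃ a e : ℝ, a ≠ 0 ∧ (e = 1 ∨ e = -1) ∧ z = e * a ^ 4 := by
  obtain ⟨b, e, hb, he, rfl, -⟩ := exists_sign_mul_sq hz 0
  obtain ⟨a, e', ha, he', rfl, -⟩ := exists_sign_mul_sq hb 0
  exact ⟨a, e, ha, he, by rcases he' with rfl | rfl <;> ring⟩

lemma exists_translate {a b c d e f g h i j e' f' g' : ℝ} (r u : ℝ)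
    (he : e' = 3 * a * r + b * u + e) (hf : f' = 2 * b * r + 2 * c * u + f)
    (hg : g' = c * r + 3 * d * u + g) :
    ∃ h' i' j' : ℝ, FunEquiv (cubicFun a b c d e f g h i j)
      (cubicFun a b c d e' f' g' h' i' j') := by
  refine ⟨3 * a * r ^ 2 + 2 * b * r * u + c * u ^ 2 + 2 * e * r + f * u + h,
    b * r ^ 2 + 2 * c * r * u + 3 * d * u ^ 2 + f * r + 2 * g * u + i,
    cubicFun a b c d e f g h i j r u, 1, 0, r, 0, 1, u, 1, by simp, by simp, fun x y => ?_⟩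
  subst he hf hg
  simp only [cubicFun]
  ring

lemma classified_of_scale {a b c d e f g h i j a' b' c' d' e' f' g' h' i' j' : ℝ} (p t k : ℝ)
    (hp : p ≠ 0) (ht : t ≠ 0) (hk : k ≠ 0)
    (ha : a * p ^ 3 = k * a') (hb : b * (p ^ 2 * t) = k * b') (hc : c * (p * t ^ 2) = k * c')
    (hd : d * t ^ 3 = k * d') (he : e * p ^ 2 = k * e') (hf : f * (p * t) = k * f')
    (hg : g * t ^ 2 = k * g') (hh : h * p = k * h') (hi : i * t = k * i') (hj : j = k * j')
    (H : Classified (cubicFun a' b' c' d' e' f' g' h' i' j')) :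
    Classified (cubicFun a b c d e f g h i j) := by
  refine Classified.of_funEquiv ⟨p, 0, 0, 0, t, 0, k, by simp [hp, ht], hk, fun x y => ?_⟩ H
  simp only [cubicFun]
  linear_combination x ^ 3 * ha + x ^ 2 * y * hb + x * y ^ 2 * hc + y ^ 3 * hd + x ^ 2 * he
    + x * y * hf + y ^ 2 * hg + x * hh + y * hi + hj

lemma classified_A_reduced (k H I J : ℝ) : Classified (cubicFun 1 0 1 0 k 0 0 H I J) := by
  by_cases hk : k = 0
  · subst hk
    by_cases hI : I = 0
    · subst hI
      by_cases hH : H = 0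
      · subst hH
        by_cases hJ : J = 0
        · exact classified_normalA (by simp [NormalA, hJ])
        · obtain ⟨a, ha, rfl⟩ := exists_cube_root hJ
          refine classified_of_scale a a (a ^ 3) ha ha hJ ?_ ?_ ?_ ?_ ?_ ?_ ?_ ?_ ?_ ?_
            (classified_normalA (k := 0) (H := 0) (I := 0) (J := 1) (by simp [NormalA])) <;> ring
      · obtain ⟨a, e, ha, he, rfl, hJ⟩ := exists_sign_mul_sq hH J
        refine classified_of_scale a a (a ^ 3) ha ha (by positivity) ?_ ?_ ?_ ?_ ?_ ?_ ?_ ?_ ?_ ?_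
          (classified_normalA (k := 0) (H := e) (I := 0) (J := J / a ^ 3)
            (by simp only [NormalA]; tauto)) <;> field_simp <;> ring
    · obtain ⟨a, e, ha, he, rfl, hJ⟩ := exists_sign_mul_sq hI J
      have he2 : e ^ 2 = 1 := by rcases he with rfl | rfl <;> norm_num
      refine classified_of_scale a (e * a) (a ^ 3) ha (by rintro h; simp_all) (by positivity)
        ?_ ?_ ?_ ?_ ?_ ?_ ?_ ?_ ?_ ?_
        (classified_normalA (k := 0) (H := H / a ^ 2) (I := 1) (J := J / a ^ 3)
          (by simp only [NormalA]; tauto)) <;> field_simp <;> simp [he2]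
  · have key : ∀ σ : ℝ, σ ^ 2 = 1 → 0 ≤ σ * I → Classified (cubicFun 1 0 1 0 k 0 0 H I J) := by
      intro σ hσ hI
      refine classified_of_scale k (σ * k) (k ^ 3) hk (by rintro h; simp_all) (by positivity)
        ?_ ?_ ?_ ?_ ?_ ?_ ?_ ?_ ?_ ?_
        (classified_normalA (k := 1) (H := H / k ^ 2) (I := σ * I / k ^ 2) (J := J / k ^ 3)
          (Or.inl ⟨rfl, by positivity⟩)) <;> field_simp <;> simp [hσ]
    rcases le_total 0 I with hI | hI
    · exact key 1 (by norm_num) (by linarith)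
    · exact key (-1) (by norm_num) (by linarith)

lemma classified_A (e f g h i j : ℝ) : Classified (cubicFun 1 0 1 0 e f g h i j) := by
  obtain ⟨h', i', j', H⟩ := exists_translate (a := 1) (b := 0) (c := 1) (d := 0) (e := e) (f := f)
    (g := g) (h := h) (i := i) (j := j) (e' := e - 3 * g) (f' := 0) (g' := 0) (-g) (-f / 2)
    (by ring) (by ring) (by ring)
  exact Classified.of_funEquiv H (classified_A_reduced _ _ _ _)

lemma classified_B_one (H I J : ℝ) : Classified (cubicFun 1 0 (-1) 0 0 0 (-1) H I J) := by
  wlog hI : 0 ≤ I generalizing I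
  · refine Classified.of_funEquiv ⟨1, 0, 0, 0, -1, 0, 1, by norm_num, by norm_num, fun x y => ?_⟩
      (this (-I) (by linarith))
    simp only [cubicFun]
    ring
  by_cases h1 : H + I ≤ -(3/4 : ℝ)
  · exact classified_normalB (Or.inl ⟨rfl, hI, h1⟩)
  by_cases h2 : H - I ≤ -(3/4 : ℝ)
  · refine Classified.of_funEquiv ⟨-1/2, -1/2, -3/4, -3/2, 1/2, -3/4, 1, by norm_num, by norm_num,
      fun x y => ?_⟩ (classified_normalB (k := 1) (H := -(H + 3 / 4 + 3 * I) / 2 - 3 / 4)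
        (I := (I - H - 3 / 4) / 2)
        (J := J - H / 2 + (-(H + 3 / 4 + 3 * I) / 2 - 3 / 4) / 2)
        (Or.inl ⟨rfl, by linarith, by linarith⟩))
    simp only [cubicFun]
    ring
  · refine Classified.of_funEquiv ⟨-1/2, 1/2, -3/4, -3/2, -1/2, -3/4, 1, by norm_num, by norm_num,
      fun x y => ?_⟩ (classified_normalB (k := 1) (H := -(H + 3 / 4 + 3 * I) / 2 - 3 / 4)
        (I := -(I - H - 3 / 4) / 2)
        (J := J - H / 2 + (-(H + 3 / 4 + 3 * I) / 2 - 3 / 4) / 2)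
        (Or.inl ⟨rfl, by linarith, by linarith⟩))
    simp only [cubicFun]
    ring

lemma classified_B_chamber {H I : ℝ} (J : ℝ) (hI : I < 0) (h1 : H ≤ -I) (h2 : I ≤ H) :
    Classified (cubicFun 1 0 (-1) 0 0 0 0 H I J) := by
  obtain ⟨a, e, ha, he, rfl, hJ⟩ := exists_sign_mul_sq hI.ne J
  have ha2 : 0 < a ^ 2 := by positivity
  obtain rfl : e = -1 := by
    refine he.resolve_left ?_
    rintro rfl
    linarith
  refine classified_of_scale a a (a ^ 3) ha ha (by positivity)
    ?_ ?_ ?_ ?_ ?_ ?_ ?_ ?_ ?_ ?_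
    (classified_normalB (k := 0) (H := H / a ^ 2) (I := -1) (J := J / a ^ 3)
      (Or.inr (Or.inl ⟨rfl, rfl, hJ, by rw [le_div_iff₀ ha2]; linarith,
        by rw [div_le_iff₀ ha2]; linarith⟩))) <;> field_simp <;> ring

lemma classified_B_zero (H I J : ℝ) : Classified (cubicFun 1 0 (-1) 0 0 0 0 H I J) := by
  wlog hI : I ≤ 0 generalizing I
  · refine Classified.of_funEquiv ⟨1, 0, 0, 0, -1, 0, 1, by norm_num, by norm_num, fun x y => ?_⟩
      (this (-I) (by linarith))
    simp only [cubicFun]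
    ring
  by_cases h1 : H ≤ -I
  · by_cases h2 : I ≤ H
    · rcases hI.lt_or_eq with hI | rfl
      · exact classified_B_chamber J hI h1 h2
      · obtain rfl : H = 0 := by linarith
        by_cases hJ : J = 0
        · simpa using classified_normalB (k := 0) (H := 0) (I := 0) (J := J) (by simp [NormalB, hJ])
        · obtain ⟨a, ha, rfl⟩ := exists_cube_root hJ
          refine classified_of_scale a a (a ^ 3) ha ha hJ ?_ ?_ ?_ ?_ ?_ ?_ ?_ ?_ ?_ ?_
            (classified_normalB (k := 0) (H := 0) (I := 0) (J := 1) (by simp [NormalB])) <;> ring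
    · refine Classified.of_funEquiv ⟨-1/2, 1/2, 0, 3/2, 1/2, 0, 1, by norm_num, by norm_num,
        fun x y => ?_⟩ (classified_B_chamber (H := (-H + 3 * I) / 2) (I := (H + I) / 2) J
          (by linarith) (by linarith) (by linarith))
      simp only [cubicFun]
      ring
  · refine Classified.of_funEquiv ⟨-1/2, -1/2, 0, -3/2, 1/2, 0, 1, by norm_num, by norm_num,
      fun x y => ?_⟩ (classified_B_chamber (H := -(H + 3 * I) / 2) (I := (I - H) / 2) J
        (by linarith) (by linarith) (by linarith))
    simp only [cubicFun]
    ring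

lemma classified_B (e f g h i j : ℝ) : Classified (cubicFun 1 0 (-1) 0 e f g h i j) := by
  obtain ⟨h', i', j', H⟩ := exists_translate (a := 1) (b := 0) (c := -1) (d := 0) (e := e) (f := f)
    (g := g) (h := h) (i := i) (j := j) (e' := 0) (f' := 0) (g' := g + e / 3) (-e / 3) (f / 2)
    (by ring) (by ring) (by ring)
  refine Classified.of_funEquiv H ?_
  generalize g + e / 3 = k
  by_cases hk : k = 0
  · subst hk
    exact classified_B_zero _ _ _
  · refine classified_of_scale (-k) (-k) (-k ^ 3) (by simpa) (by simpa) (by simpa)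
      ?_ ?_ ?_ ?_ ?_ ?_ ?_ ?_ ?_ ?_
      (classified_B_one (h' / k ^ 2) (i' / k ^ 2) (-j' / k ^ 3)) <;> field_simp <;> ring

lemma classified_C_reduced (k H I J : ℝ) : Classified (cubicFun 0 1 0 0 0 0 k H I J) := by
  by_cases hk : k = 0
  · subst hk
    by_cases hH : H = 0
    · subst hH
      by_cases hI : I = 0
      · subst hI
        by_cases hJ : J = 0
        · exact classified_normalC (by simp [NormalC, hJ])
        · refine classified_of_scale 1 (-J) (-J) one_ne_zero (by simpa) (by simpa)
            ?_ ?_ ?_ ?_ ?_ ?_ ?_ ?_ ?_ ?_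
            (classified_normalC (k := 0) (H := 0) (I := 0) (J := -1) (by simp [NormalC])) <;> ring
      · obtain ⟨a, e, ha, he, rfl, -⟩ := exists_sign_mul_sq hI 0
        by_cases hJ : J = 0
        · subst hJ
          refine classified_of_scale a 1 (a ^ 2) ha one_ne_zero (by positivity)
            ?_ ?_ ?_ ?_ ?_ ?_ ?_ ?_ ?_ ?_
            (classified_normalC (k := 0) (H := 0) (I := e) (J := 0) (by simp [NormalC, he])) <;>
            ring
        · refine classified_of_scale a (J / a ^ 2) J ha (by positivity) hJ
            ?_ ?_ ?_ ?_ ?_ ?_ ?_ ?_ ?_ ?_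
            (classified_normalC (k := 0) (H := 0) (I := e) (J := 1) (by simp [NormalC, he])) <;>
            field_simp <;> ring
    · by_cases hI : I = 0
      · subst hI
        by_cases hJ : J = 0
        · subst hJ
          refine classified_of_scale 1 (-H) (-H) one_ne_zero (by simpa) (by simpa)
            ?_ ?_ ?_ ?_ ?_ ?_ ?_ ?_ ?_ ?_
            (classified_normalC (k := 0) (H := -1) (I := 0) (J := 0) (by simp [NormalC])) <;> ring
        · refine classified_of_scale (-J / H) (H ^ 2 / J) J (div_ne_zero (by simpa) hH)
            (by positivity) hJ
            ?_ ?_ ?_ ?_ ?_ ?_ ?_ ?_ ?_ ?_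
            (classified_normalC (k := 0) (H := -1) (I := 0) (J := 1) (by simp [NormalC])) <;>
            field_simp <;> ring
      · obtain ⟨a, e, ha, he, rfl, hJ⟩ := exists_sign_mul_sq hI (-J / H)
        have hJ' : 0 ≤ -J / (a * H) := by
          have : -J / (a * H) = a ^ 2 * (-J / H / a ^ 3) := by field_simp
          rw [this]
          positivity
        refine classified_of_scale a (-H / a) (-(a * H)) ha (div_ne_zero (by simpa) ha)
          (by simp [ha, hH])
          ?_ ?_ ?_ ?_ ?_ ?_ ?_ ?_ ?_ ?_
          (classified_normalC (k := 0) (H := -1) (I := e) (J := -J / (a * H))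
            (by simp [NormalC, he, hJ'])) <;>
          field_simp <;> ring
  · by_cases hH : H = 0
    · subst hH
      by_cases hI : I = 0
      · subst hI
        by_cases hJ : J = 0
        · subst hJ
          refine classified_of_scale 1 (1 / k) (1 / k) one_ne_zero (by positivity) (by positivity)
            ?_ ?_ ?_ ?_ ?_ ?_ ?_ ?_ ?_ ?_
            (classified_normalC (k := 1) (H := 0) (I := 0) (J := 0) (by simp [NormalC])) <;>
            field_simp <;> ring
        · obtain ⟨a, e, ha, he, h⟩ := exists_sign_mul_pow_four (mul_ne_zero hJ hk)
          obtain rfl : J = e * a ^ 4 / k := by field_simp; linarith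
          refine classified_of_scale a (a ^ 2 / k) (a ^ 4 / k) ha (by positivity) (by positivity)
            ?_ ?_ ?_ ?_ ?_ ?_ ?_ ?_ ?_ ?_
            (classified_normalC (k := 1) (H := 0) (I := 0) (J := e) (by simp [NormalC, he])) <;>
            field_simp <;> ring
      · obtain ⟨a, e, ha, he, rfl, -⟩ := exists_sign_mul_sq hI 0
        refine classified_of_scale a (a ^ 2 / k) (a ^ 4 / k) ha (by positivity) (by positivity)
          ?_ ?_ ?_ ?_ ?_ ?_ ?_ ?_ ?_ ?_
          (classified_normalC (k := 1) (H := 0) (I := e) (J := J * k / a ^ 4)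
            (by simp [NormalC, he])) <;>
          field_simp <;> ring
    · obtain ⟨a, ha, h⟩ := exists_cube_root (neg_ne_zero.mpr (mul_ne_zero hH hk))
      obtain rfl : H = -(a ^ 3 / k) := by field_simp; linarith
      refine classified_of_scale a (a ^ 2 / k) (a ^ 4 / k) ha (by positivity) (by positivity)
        ?_ ?_ ?_ ?_ ?_ ?_ ?_ ?_ ?_ ?_
        (classified_normalC (k := 1) (H := -1) (I := I / a ^ 2) (J := J * k / a ^ 4)
          (by simp [NormalC])) <;>
        field_simp <;> ring

lemma classified_C (e f g h i j : ℝ) : Classified (cubicFun 0 1 0 0 e f g h i j) := by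
  obtain ⟨h', i', j', H⟩ := exists_translate (a := 0) (b := 1) (c := 0) (d := 0) (e := e) (f := f)
    (g := g) (h := h) (i := i) (j := j) (e' := 0) (f' := 0) (g' := g) (-f / 2) (-e)
    (by ring) (by ring) (by ring)
  exact Classified.of_funEquiv H (classified_C_reduced _ _ _ _)

lemma classified_cuspidal_scale {g a H J : ℝ} (ha : a * g < 0)
    (h : NormalD 0 (-1) (H / a ^ 2) 0 (J / a ^ 3)) :
    Classified (cubicFun 1 0 0 0 0 0 g H 0 J) := by
  have ha0 : a ≠ 0 := left_ne_zero_of_mul ha.ne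
  have hg0 : g ≠ 0 := right_ne_zero_of_mul ha.ne
  have hpos : 0 < -a ^ 3 / g := by
    have : -a ^ 3 / g = (a / g) ^ 2 * -(a * g) := by field_simp
    rw [this]
    exact mul_pos (by positivity) (by linarith)
  have hsq : √(-a ^ 3 / g) ^ 2 = -a ^ 3 / g := Real.sq_sqrt hpos.le
  refine classified_of_scale a √(-a ^ 3 / g) (a ^ 3) ha0 (Real.sqrt_pos.mpr hpos).ne'
    (by positivity) ?_ ?_ ?_ ?_ ?_ ?_ (by rw [hsq]; field_simp) ?_ ?_ ?_
    (classified_normalD h) <;> field_simp <;> ring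

lemma exists_pow_three_mul_neg {J g : ℝ} (hJ : J ≠ 0) (hg : g ≠ 0) :
    ∃ a : ℝ, a * g < 0 ∧ (J / a ^ 3 = 1 ∨ J / a ^ 3 = -1) := by
  obtain ⟨a, ha, rfl⟩ := exists_cube_root hJ
  rcases (mul_ne_zero ha hg).lt_or_gt with h | h
  · exact ⟨a, h, Or.inl (by field_simp)⟩
  · exact ⟨-a, by linarith, Or.inr (by field_simp)⟩

lemma exists_sq_mul_neg {H g : ℝ} (hH : H ≠ 0) (hg : g ≠ 0) :
    ∃ a : ℝ, a * g < 0 ∧ (H / a ^ 2 = 1 ∨ H / a ^ 2 = -1) := by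
  obtain ⟨a, e, ha, he, rfl, -⟩ := exists_sign_mul_sq hH 0
  have key : ∀ b : ℝ, b ^ 2 = a ^ 2 → e * a ^ 2 / b ^ 2 = e := by
    intro b hb
    rw [hb]
    field_simp
  rcases (mul_ne_zero ha hg).lt_or_gt with h | h
  · exact ⟨a, h, by rwa [key a rfl]⟩
  · exact ⟨-a, by linarith, by rwa [key (-a) (by ring)]⟩

lemma classified_cuspidal {g : ℝ} (hg : g ≠ 0) (H J : ℝ) :
    Classified (cubicFun 1 0 0 0 0 0 g H 0 J) := by
  by_cases hH : H = 0
  · subst hH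
    by_cases hJ : J = 0
    · subst hJ
      exact classified_cuspidal_scale (a := -g) (by nlinarith [pow_two_pos_of_ne_zero hg])
        (by simp [NormalD])
    · obtain ⟨a, ha, h⟩ := exists_pow_three_mul_neg hJ hg
      exact classified_cuspidal_scale ha (by simp [NormalD, h])
  · obtain ⟨a, ha, h⟩ := exists_sq_mul_neg hH hg
    exact classified_cuspidal_scale ha (by simp [NormalD, h])

lemma classified_D (e f g h i j : ℝ) : Classified (cubicFun 1 0 0 0 e f g h i j) := by
  by_cases hg : g = 0
  · subst hg
    by_cases hf : f = 0
    · subst hf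
      obtain ⟨H, I, J, hF⟩ := exists_translate (a := 1) (b := 0) (c := 0) (d := 0) (e := e)
        (f := 0) (g := 0) (h := h) (i := i) (j := j) (e' := 0) (f' := 0) (g' := 0) (-e / 3) 0
        (by ring) (by ring) (by ring)
      refine Classified.of_funEquiv hF ?_
      by_cases hI : I = 0
      · subst hI
        by_cases hH : H = 0
        · subst hH
          by_cases hJ : J = 0
          · exact classified_normalD (by simp [NormalD, hJ])
          · obtain ⟨a, ha, rfl⟩ := exists_cube_root hJ
            refine classified_of_scale a a (a ^ 3) ha ha hJ ?_ ?_ ?_ ?_ ?_ ?_ ?_ ?_ ?_ ?_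
              (classified_normalD (m := 0) (n := 0) (H := 0) (I := 0) (J := 1)
                (by simp [NormalD])) <;> ring
        · obtain ⟨a, e', ha, he, rfl, hJ⟩ := exists_sign_mul_sq hH J
          refine classified_of_scale a a (a ^ 3) ha ha (by positivity)
            ?_ ?_ ?_ ?_ ?_ ?_ ?_ ?_ ?_ ?_
            (classified_normalD (m := 0) (n := 0) (H := e') (I := 0) (J := J / a ^ 3)
              (by simp [NormalD, he, hJ])) <;> field_simp <;> ring
      · refine Classified.of_funEquiv ⟨1, 0, 0, -H / I, -1 / I, -J / I, 1, by simpa, one_ne_zero,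
          fun x y => ?_⟩ (classified_normalD (m := 0) (n := 0) (H := 0) (I := -1) (J := 0)
            (by simp [NormalD]))
        simp only [cubicFun]
        field_simp
        ring
    · obtain ⟨r, hr⟩ : ∃ r, f * r + i = 0 := ⟨-i / f, by field_simp; ring⟩
      obtain ⟨s, hs⟩ : ∃ s, 3 * r + e + f * s = 0 := ⟨-(3 * r + e) / f, by field_simp; ring⟩
      obtain ⟨u, hu⟩ : ∃ u, 3 * r ^ 2 + 2 * e * r + f * (u + r * s) + h + i * s = 0 :=
        ⟨-(3 * r ^ 2 + 2 * e * r + f * (r * s) + h + i * s) / f, by field_simp; ring⟩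
      obtain ⟨J, hJ⟩ : ∃ J, J = r ^ 3 + e * r ^ 2 + f * r * u + h * r + i * u + j := ⟨_, rfl⟩
      refine Classified.of_funEquiv (G := cubicFun 1 0 0 0 0 f 0 0 0 J)
        ⟨1, 0, r, s, 1, u, 1, by simp, one_ne_zero, fun x y => ?_⟩ ?_
      · simp only [cubicFun]
        linear_combination y * hr + x ^ 2 * hs + x * hu - hJ
      · by_cases hJ : J = 0
        · subst hJ
          refine classified_of_scale 1 (-1 / f) 1 one_ne_zero
            (div_ne_zero (by simp) hf) one_ne_zero
            ?_ ?_ ?_ ?_ ?_ ?_ ?_ ?_ ?_ ?_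
            (classified_normalD (m := -1) (n := 0) (H := 0) (I := 0) (J := 0)
              (by simp [NormalD])) <;> field_simp <;> ring
        · obtain ⟨a, ha, rfl⟩ := exists_cube_root hJ
          refine classified_of_scale a (-a ^ 2 / f) (a ^ 3) ha
            (div_ne_zero (by simpa) hf) (by positivity)
            ?_ ?_ ?_ ?_ ?_ ?_ ?_ ?_ ?_ ?_
            (classified_normalD (m := -1) (n := 0) (H := 0) (I := 0) (J := 1)
              (by simp [NormalD])) <;> field_simp <;> ring
  · obtain ⟨s, hs⟩ : ∃ s, f + 2 * g * s = 0 := ⟨-f / (2 * g), by field_simp; ring⟩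
    obtain ⟨r, hr⟩ : ∃ r, 3 * r + e + f * s + g * s ^ 2 = 0 :=
      ⟨-(e + f * s + g * s ^ 2) / 3, by ring⟩
    obtain ⟨u, hu⟩ : ∃ u, f * r + 2 * g * u + i = 0 := ⟨-(f * r + i) / (2 * g), by field_simp; ring⟩
    refine Classified.of_funEquiv (G := cubicFun 1 0 0 0 0 0 g
      (3 * r ^ 2 + 2 * e * r + f * (u + r * s) + 2 * g * s * u + h + i * s) 0
      (r ^ 3 + e * r ^ 2 + f * r * u + g * u ^ 2 + h * r + i * u + j))
      ⟨1, 0, r, s, 1, u, 1, by simp, one_ne_zero, fun x y => ?_⟩ (classified_cuspidal hg _ _)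
    simp only [cubicFun]
    linear_combination x * y * hs + x ^ 2 * hr + y * hu

/-- Every cubic with the given leading form is classified. -/
def LeadingClassified (a b c d : ℝ) : Prop :=
  ∀ e f g h i j, Classified (cubicFun a b c d e f g h i j)

lemma LeadingClassified.of_linear {a b c d a' b' c' d' : ℝ} (p q s t k : ℝ)
    (hd : p * t - q * s ≠ 0) (hk : k ≠ 0)
    (h1 : a * p ^ 3 + b * (p ^ 2 * s) + c * (p * s ^ 2) + d * s ^ 3 = k * a')
    (h2 : 3 * a * p ^ 2 * q + b * (p ^ 2 * t + 2 * p * q * s) + c * (2 * p * s * t + q * s ^ 2)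
        + 3 * d * s ^ 2 * t = k * b')
    (h3 : 3 * a * p * q ^ 2 + b * (q ^ 2 * s + 2 * p * q * t) + c * (p * t ^ 2 + 2 * q * s * t)
        + 3 * d * s * t ^ 2 = k * c')
    (h4 : a * q ^ 3 + b * (q ^ 2 * t) + c * (q * t ^ 2) + d * t ^ 3 = k * d')
    (H : LeadingClassified a' b' c' d') : LeadingClassified a b c d := by
  intro e f g h i j
  refine Classified.of_funEquiv ⟨p, q, 0, s, t, 0, k, hd, hk, fun x y => ?_⟩
    (H ((e * p ^ 2 + f * (p * s) + g * s ^ 2) / k)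
      ((2 * e * p * q + f * (p * t + q * s) + 2 * g * s * t) / k)
      ((e * q ^ 2 + f * (q * t) + g * t ^ 2) / k) ((h * p + i * s) / k) ((h * q + i * t) / k)
      (j / k))
  simp only [cubicFun]
  field_simp
  linear_combination x ^ 3 * h1 + x ^ 2 * y * h2 + x * y ^ 2 * h3 + y ^ 3 * h4

lemma leadingClassified_of_y_cube_eq_zero {a b c : ℝ} (h : ¬ (a = 0 ∧ b = 0 ∧ c = 0)) :
    LeadingClassified a b c 0 := by
  by_cases hc : c = 0
  · subst hc
    by_cases hb : b = 0
    · subst hb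
      have ha : a ≠ 0 := fun ha => h ⟨ha, rfl, rfl⟩
      exact LeadingClassified.of_linear 1 0 0 1 a (by simp) ha (by ring) (by ring) (by ring)
        (by ring) (a' := 1) (b' := 0) (c' := 0) (d' := 0) classified_D
    · exact LeadingClassified.of_linear 1 0 (-a / b) (1 / b) 1 (by simpa) one_ne_zero
        (by field_simp; ring) (by field_simp; ring) (by ring)
        (by ring) (a' := 0) (b' := 1) (c' := 0) (d' := 0) classified_C
  · refine LeadingClassified.of_linear 1 0 (-b / (2 * c)) 1 1 (by simp) one_ne_zero
      (a' := a - b ^ 2 / (4 * c)) (b' := 0) (c' := c) (d' := 0) (by field_simp; ring)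
      (by field_simp; ring) (by ring) (by ring) ?_
    generalize a - b ^ 2 / (4 * c) = a'
    by_cases ha : a' = 0
    · subst ha
      exact LeadingClassified.of_linear 0 1 1 0 c (by simp) hc (by ring) (by ring) (by ring)
        (by ring) (a' := 0) (b' := 1) (c' := 0) (d' := 0) classified_C
    · rcases (div_ne_zero ha hc).lt_or_gt with hac | hac
      · have hpos : 0 < -a' / c := by rw [neg_div]; linarith
        have hsq : √(-a' / c) ^ 2 = -a' / c := Real.sq_sqrt hpos.le
        exact LeadingClassified.of_linear 1 0 0 √(-a' / c) a'
          (by simpa using (Real.sqrt_pos.mpr hpos).ne') ha (by ring) (by ring)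
          (by simp only [hsq]; field_simp; ring) (by ring)
          (a' := 1) (b' := 0) (c' := -1) (d' := 0) classified_B
      · have hsq : √(a' / c) ^ 2 = a' / c := Real.sq_sqrt hac.le
        exact LeadingClassified.of_linear 1 0 0 √(a' / c) a'
          (by simpa using (Real.sqrt_pos.mpr hac).ne') ha (by ring) (by ring)
          (by simp only [hsq]; field_simp; ring) (by ring)
          (a' := 1) (b' := 0) (c' := 1) (d' := 0) classified_A

/-- A real binary cubic form vanishes at some point of the unit circle. -/
lemma exists_unit_root (a b c d : ℝ) : ∃ q t : ℝ, q ^ 2 + t ^ 2 = 1 ∧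
    a * q ^ 3 + b * (q ^ 2 * t) + c * (q * t ^ 2) + d * t ^ 3 = 0 := by
  let φ : ℝ → ℝ := fun z => a * Real.cos z ^ 3 + b * (Real.cos z ^ 2 * Real.sin z)
    + c * (Real.cos z * Real.sin z ^ 2) + d * Real.sin z ^ 3
  have hφ : Continuous φ := by fun_prop
  have h0 : φ 0 = a := by simp [φ]
  have hπ : φ Real.pi = -a := by simp [φ]; ring
  have hmem : (0 : ℝ) ∈ Set.uIcc (φ 0) (φ Real.pi) := by
    rw [h0, hπ, Set.mem_uIcc]
    rcases le_total 0 a with h | h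
    · exact Or.inr ⟨by linarith, h⟩
    · exact Or.inl ⟨h, by linarith⟩
  obtain ⟨z, -, hz⟩ := intermediate_value_uIcc hφ.continuousOn hmem
  exact ⟨Real.cos z, Real.sin z, Real.cos_sq_add_sin_sq z, hz⟩

lemma leadingClassified {a b c d : ℝ} (h : ¬ (a = 0 ∧ b = 0 ∧ c = 0 ∧ d = 0)) :
    LeadingClassified a b c d := by
  obtain ⟨q, t, hqt, h0⟩ := exists_unit_root a b c d
  refine LeadingClassified.of_linear t q (-q) t 1 (by nlinarith)
    one_ne_zero (one_mul _).symm (one_mul _).symm (one_mul _).symm (by rw [h0, mul_zero])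
    (leadingClassified_of_y_cube_eq_zero ?_)
  rintro ⟨h1, h2, h3⟩
  have hN (z : ℝ) : z = z * (q ^ 2 + t ^ 2) ^ 3 := by rw [hqt]; ring
  refine h ⟨?_, ?_, ?_, ?_⟩
  · rw [hN a]
    linear_combination t ^ 3 * h1 + t ^ 2 * q * h2 + t * q ^ 2 * h3 + q ^ 3 * h0
  · rw [hN b]
    linear_combination -3 * t ^ 2 * q * h1 + (t ^ 3 - 2 * t * q ^ 2) * h2
      + (2 * q * t ^ 2 - q ^ 3) * h3 + 3 * q ^ 2 * t * h0
  · rw [hN c]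
    linear_combination 3 * t * q ^ 2 * h1 + (q ^ 3 - 2 * t ^ 2 * q) * h2
      + (t ^ 3 - 2 * q ^ 2 * t) * h3 + 3 * q * t ^ 2 * h0
  · rw [hN d]
    linear_combination -q ^ 3 * h1 + q ^ 2 * t * h2 - q * t ^ 2 * h3 + t ^ 3 * h0

lemma exists_table_affEquiv {f : P2} (hf : f.totalDegree = 3) :
    ∃ g : P2, InTable g ∧ AffEquiv f g := by
  obtain ⟨a, b, c, d, e, f', g, h, i, j, rfl⟩ := exists_eq_cubicPoly hf.le
  have hlead : ¬ (a = 0 ∧ b = 0 ∧ c = 0 ∧ d = 0) := by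
    rintro ⟨rfl, rfl, rfl, rfl⟩
    have := cubicPoly_totalDegree_le_two e f' g h i j
    omega
  obtain ⟨F, hF, H⟩ := leadingClassified hlead e f' g h i j
  refine ⟨F, hF, affEquiv_iff_funEquiv.mpr ?_⟩
  simpa only [eval_cubicPoly] using H

lemma funEquiv_A {k₁ H₁ I₁ J₁ k₂ H₂ I₂ J₂ : ℝ}
    (h : FunEquiv (cubicFun 1 0 1 0 k₁ 0 0 H₁ I₁ J₁) (cubicFun 1 0 1 0 k₂ 0 0 H₂ I₂ J₂)) :
    ∃ p : ℝ, p ≠ 0 ∧ k₁ = p * k₂ ∧ H₁ = p ^ 2 * H₂ ∧ (I₁ = p ^ 2 * I₂ ∨ I₁ = -(p ^ 2 * I₂)) ∧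
      J₁ = p ^ 3 * J₂ := by
  obtain ⟨p, q, r, s, t, u, k, hd, hk, ⟨c1, c2, c3, c4⟩, ⟨d1, d2, d3⟩, l1, l2, l3⟩ := h.coeff_eq
  obtain rfl : q = 0 := by
    have : q * (q ^ 2 + t ^ 2) = 0 := by linear_combination c4
    rcases mul_eq_zero.mp this with h | h
    · exact h
    · nlinarith [sq_nonneg q, sq_nonneg t]
  have hp : p ≠ 0 := by rintro rfl; simp at hd
  have ht : t ≠ 0 := by rintro rfl; simp at hd
  obtain rfl : s = 0 := by
    have : (p * t) * s = 0 := by linear_combination c2 / 2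
    exact (mul_eq_zero.mp this).resolve_left (mul_ne_zero hp ht)
  obtain rfl : k = p ^ 3 := by linear_combination -c1
  obtain rfl : u = 0 := by
    have : (p * t) * u = 0 := by linear_combination d2 / 2
    exact (mul_eq_zero.mp this).resolve_left (mul_ne_zero hp ht)
  obtain rfl : r = 0 := by
    have : t ^ 2 * r = 0 := by linear_combination d3
    exact (mul_eq_zero.mp this).resolve_left (pow_ne_zero 2 ht)
  have ht2 : t = p ∨ t = -p := by
    refine sq_eq_sq_iff_eq_or_eq_neg.mp (mul_left_cancel₀ hp ?_)
    linear_combination c3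
  refine ⟨p, hp, mul_left_cancel₀ (pow_ne_zero 2 hp) (by linear_combination d1),
    mul_left_cancel₀ hp (by linear_combination l1), ?_, by linear_combination l3⟩
  rcases ht2 with rfl | rfl
  · exact Or.inl (mul_left_cancel₀ hp (by linear_combination l2))
  · exact Or.inr (mul_left_cancel₀ hp (by linear_combination -l2))

lemma sign_unique {m e e' : ℝ} (hm : 0 < m) (he : e = 1 ∨ e = -1) (he' : e' = 1 ∨ e' = -1)
    (h : e = m * e') : e = e' ∧ m = 1 := by
  rcases he with rfl | rfl <;> rcases he' with rfl | rfl <;> constructor <;> linarith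

lemma sign_ne_scale_zero {m e : ℝ} (he : e = 1 ∨ e = -1) : e ≠ m * 0 := by
  rcases he with rfl | rfl <;> norm_num

lemma zero_ne_scale_sign {m e : ℝ} (hm : m ≠ 0) (he : e = 1 ∨ e = -1) : 0 ≠ m * e := by
  rcases he with rfl | rfl
  · rw [mul_one]
    exact hm.symm
  · intro h
    exact hm (by linarith)

lemma eq_of_sq_eq_one {p J J' : ℝ} (hp : p ^ 2 = 1) (hJ : 0 ≤ J) (hJ' : 0 ≤ J')
    (h : J = p ^ 3 * J') : J = J' := by
  rcases sq_eq_one_iff.mp hp with rfl | rfl <;> linarith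

lemma eq_of_eq_scale {m e J J' : ℝ} (hm : m ≠ 0) (he : e ≠ 0) (hJ : J = e ∨ J = 0)
    (hJ' : J' = e ∨ J' = 0) (h : J = m * J') : J = J' := by
  rcases hJ' with rfl | rfl
  · rcases hJ with hJ | hJ
    · exact hJ
    · exact absurd (h.symm.trans hJ) (mul_ne_zero hm he)
  · rw [h, mul_zero]

lemma normalA_unique {k₁ H₁ I₁ J₁ k₂ H₂ I₂ J₂ : ℝ} (h₁ : NormalA k₁ H₁ I₁ J₁)
    (h₂ : NormalA k₂ H₂ I₂ J₂)
    (h : FunEquiv (cubicFun 1 0 1 0 k₁ 0 0 H₁ I₁ J₁) (cubicFun 1 0 1 0 k₂ 0 0 H₂ I₂ J₂)) :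
    k₁ = k₂ ∧ H₁ = H₂ ∧ I₁ = I₂ ∧ J₁ = J₂ := by
  obtain ⟨p, hp, hk, hH, hI, hJ⟩ := funEquiv_A h
  have hp2 : 0 < p ^ 2 := by positivity
  have hp3 : p ^ 3 ≠ 0 := by positivity
  rcases h₁ with ⟨rfl, hI₁⟩ | ⟨rfl, rfl, hJ₁⟩ | ⟨rfl, rfl, hH₁, hJ₁⟩ | ⟨rfl, rfl, rfl, hJ₁⟩ <;>
  rcases h₂ with ⟨rfl, hI₂⟩ | ⟨rfl, rfl, hJ₂⟩ | ⟨rfl, rfl, hH₂, hJ₂⟩ | ⟨rfl, rfl, rfl, hJ₂⟩ <;>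
  try (first
    | (simp [hp.symm] at hk; done)
    | (simp at hI; done)
    | (exfalso; rcases hI with hI | hI <;> linarith)
    | exact absurd hH (sign_ne_scale_zero ‹_›)
    | exact absurd hH (zero_ne_scale_sign hp2.ne' ‹_›))
  · obtain rfl : p = 1 := by linarith
    refine ⟨rfl, by linarith, ?_, by linarith⟩
    rcases hI with hI | hI <;> linarith
  · have hp1 : p ^ 2 = 1 := by rcases hI with hI | hI <;> linarith
    exact ⟨rfl, by rw [hH, hp1, one_mul], rfl, eq_of_sq_eq_one hp1 hJ₁ hJ₂ hJ⟩
  · obtain ⟨hH', hp1⟩ := sign_unique hp2 hH₁ hH₂ hH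
    exact ⟨rfl, hH', rfl, eq_of_sq_eq_one hp1 hJ₁ hJ₂ hJ⟩
  · exact ⟨rfl, rfl, rfl, eq_of_eq_scale hp3 one_ne_zero hJ₁ hJ₂ hJ⟩

lemma stabilizer_B {p q s t k : ℝ} (hd : p * t - q * s ≠ 0) (hk : k ≠ 0)
    (c1 : p ^ 3 - p * s ^ 2 = k) (c2 : 3 * p ^ 2 * q - (2 * p * s * t + q * s ^ 2) = 0)
    (c3 : 3 * p * q ^ 2 - (p * t ^ 2 + 2 * q * s * t) = -k) (c4 : q ^ 3 - q * t ^ 2 = 0) :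
    p ≠ 0 ∧ ((q = 0 ∧ s = 0 ∧ (t = p ∨ t = -p) ∧ k = p ^ 3) ∨
      (q = t ∧ s = -(3 * p) ∧ (t = p ∨ t = -p) ∧ k = -(8 * p ^ 3)) ∨
      (q = -t ∧ s = 3 * p ∧ (t = p ∨ t = -p) ∧ k = -(8 * p ^ 3))) := by
  have hp : p ≠ 0 := by rintro rfl; apply hk; rw [← c1]; ring
  refine ⟨hp, ?_⟩
  have hq : q = 0 ∨ q = t ∨ q = -t := by
    have : q * ((q - t) * (q + t)) = 0 := by linear_combination c4
    rcases mul_eq_zero.mp this with h | h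
    · exact Or.inl h
    · rcases mul_eq_zero.mp h with h | h
      · exact Or.inr (Or.inl (by linarith))
      · exact Or.inr (Or.inr (by linarith))
  rcases hq with rfl | rfl | rfl
  · have ht : t ≠ 0 := by rintro rfl; simp at hd
    obtain rfl : s = 0 := by
      have : (p * t) * s = 0 := by linear_combination -c2 / 2
      exact (mul_eq_zero.mp this).resolve_left (mul_ne_zero hp ht)
    refine Or.inl ⟨rfl, rfl, sq_eq_sq_iff_eq_or_eq_neg.mp (mul_left_cancel₀ hp ?_), ?_⟩
    · linear_combination -c1 - c3
    · linear_combination -c1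
  · have hq : q ≠ 0 := by rintro rfl; simp at hd
    have hps : p - s ≠ 0 := by
      intro h
      apply hd
      linear_combination q * h
    obtain rfl : s = -(3 * p) := by
      have : (q * (p - s)) * (s + 3 * p) = 0 := by linear_combination c2
      linarith [(mul_eq_zero.mp this).resolve_left (mul_ne_zero hq hps)]
    refine Or.inr (Or.inl ⟨rfl, rfl, sq_eq_sq_iff_eq_or_eq_neg.mp (mul_left_cancel₀ hp ?_), ?_⟩)
    · linear_combination (c1 + c3) / 8
    · linear_combination -c1
  · have hq : t ≠ 0 := by rintro rfl; simp at hd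
    have hps : p + s ≠ 0 := by
      intro h
      apply hd
      linear_combination t * h
    obtain rfl : s = 3 * p := by
      have : (t * (p + s)) * (s - 3 * p) = 0 := by linear_combination c2
      linarith [(mul_eq_zero.mp this).resolve_left (mul_ne_zero hq hps)]
    refine Or.inr (Or.inr ⟨rfl, rfl, sq_eq_sq_iff_eq_or_eq_neg.mp (mul_left_cancel₀ hp ?_), ?_⟩)
    · linear_combination (c1 + c3) / 8
    · linear_combination -c1

/-- The invariants of `x³ - x·y² - k·y² + H·x + I·y + J` up to the symmetric group permuting
the asymptotic directions and up to rescaling. -/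
lemma funEquiv_B {k₁ H₁ I₁ J₁ k₂ H₂ I₂ J₂ : ℝ}
    (h : FunEquiv (cubicFun 1 0 (-1) 0 0 0 (-k₁) H₁ I₁ J₁)
      (cubicFun 1 0 (-1) 0 0 0 (-k₂) H₂ I₂ J₂)) :
    ∃ z h₁ h₂ : ℝ, z ≠ 0 ∧ k₁ = z * k₂ ∧
      h₁ = H₁ + 3 / 4 * k₁ ^ 2 ∧ h₂ = H₂ + 3 / 4 * k₂ ^ 2 ∧
      J₁ - H₁ * k₁ / 2 - k₁ ^ 3 / 8 = z ^ 3 * (J₂ - H₂ * k₂ / 2 - k₂ ^ 3 / 8) ∧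
      ((h₁ = z ^ 2 * h₂ ∧ (I₁ = z ^ 2 * I₂ ∨ I₁ = -(z ^ 2 * I₂))) ∨
       (h₁ - 3 * I₁ = -(2 * (z ^ 2 * h₂)) ∧
        (h₁ + I₁ = 2 * (z ^ 2 * I₂) ∨ h₁ + I₁ = -(2 * (z ^ 2 * I₂)))) ∨
       (h₁ + 3 * I₁ = -(2 * (z ^ 2 * h₂)) ∧
        (h₁ - I₁ = 2 * (z ^ 2 * I₂) ∨ h₁ - I₁ = -(2 * (z ^ 2 * I₂))))) := by
  obtain ⟨p, q, r, s, t, u, k, hd, hk, ⟨c1, c2, c3, c4⟩, ⟨d1, d2, d3⟩, l1, l2, l3⟩ := h.coeff_eq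
  obtain ⟨hp, hpqst⟩ := stabilizer_B hd hk (by linear_combination c1) (by linear_combination c2)
    (by linear_combination c3) (by linear_combination c4)
  have hp2 : p ^ 2 ≠ 0 := pow_ne_zero 2 hp
  rcases hpqst with ⟨rfl, rfl, ht, rfl⟩ | ⟨rfl, rfl, ht, rfl⟩ | ⟨rfl, rfl, ht, rfl⟩
  · obtain rfl : r = 0 := mul_left_cancel₀ hp2 (by linear_combination d1 / 3)
    obtain rfl : u = 0 := by
      refine mul_left_cancel₀ hp2 ?_
      rcases ht with rfl | rfl
      · linear_combination -d2 / 2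
      · linear_combination d2 / 2
    obtain rfl : k₁ = p * k₂ := by
      refine mul_left_cancel₀ hp2 ?_
      rcases ht with rfl | rfl <;> linear_combination -d3
    obtain rfl : H₁ = p ^ 2 * H₂ := mul_left_cancel₀ hp (by linear_combination l1)
    refine ⟨p, _, _, hp, rfl, rfl, rfl, by linear_combination l3, Or.inl ⟨by ring, ?_⟩⟩
    rcases ht with rfl | rfl
    · exact Or.inl (mul_left_cancel₀ hp (by linear_combination l2))
    · exact Or.inr (mul_left_cancel₀ hp (by linear_combination -l2))
  · obtain ⟨rfl, rfl⟩ : r = -(3 / 4 * k₁) ∧ u = 3 / 4 * k₁ := by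
      rcases ht with rfl | rfl
      · exact ⟨mul_left_cancel₀ hp2 (by linear_combination (d2 - 2 / 3 * d1) / 16),
          mul_left_cancel₀ hp2 (by linear_combination (d2 + 2 * d1) / 16)⟩
      · exact ⟨mul_left_cancel₀ hp2 (by linear_combination (-d2 - 2 / 3 * d1) / 16),
          mul_left_cancel₀ hp2 (by linear_combination (-d2 + 2 * d1) / 16)⟩
    obtain rfl : k₁ = -(2 * p) * k₂ := by
      refine mul_left_cancel₀ hp2 ?_
      rcases ht with rfl | rfl <;> linear_combination -d3 / 4
    refine ⟨-(2 * p), _, _, by simpa, rfl, rfl, rfl, ?_, Or.inr (Or.inl ⟨?_, ?_⟩)⟩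
    · rcases ht with rfl | rfl <;> linear_combination l3 - k₂ / 2 * l1
    · refine mul_left_cancel₀ hp ?_
      rcases ht with rfl | rfl <;> linear_combination l1
    · rcases ht with rfl | rfl
      · exact Or.inr (mul_left_cancel₀ hp (by linear_combination l2))
      · exact Or.inl (mul_left_cancel₀ hp (by linear_combination -l2))
  · obtain ⟨rfl, rfl⟩ : r = -(3 / 4 * k₁) ∧ u = -(3 / 4 * k₁) := by
      rcases ht with rfl | rfl
      · exact ⟨mul_left_cancel₀ hp2 (by linear_combination (-d2 - 2 / 3 * d1) / 16),
          mul_left_cancel₀ hp2 (by linear_combination (d2 - 2 * d1) / 16)⟩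
      · exact ⟨mul_left_cancel₀ hp2 (by linear_combination (d2 - 2 / 3 * d1) / 16),
          mul_left_cancel₀ hp2 (by linear_combination (-d2 - 2 * d1) / 16)⟩
    obtain rfl : k₁ = -(2 * p) * k₂ := by
      refine mul_left_cancel₀ hp2 ?_
      rcases ht with rfl | rfl <;> linear_combination -d3 / 4
    refine ⟨-(2 * p), _, _, by simpa, rfl, rfl, rfl, ?_, Or.inr (Or.inr ⟨?_, ?_⟩)⟩
    · rcases ht with rfl | rfl <;> linear_combination l3 - k₂ / 2 * l1
    · refine mul_left_cancel₀ hp ?_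
      rcases ht with rfl | rfl <;> linear_combination l1
    · rcases ht with rfl | rfl
      · exact Or.inl (mul_left_cancel₀ hp (by linear_combination -l2))
      · exact Or.inr (mul_left_cancel₀ hp (by linear_combination l2))

lemma normalB_unique {k₁ H₁ I₁ J₁ k₂ H₂ I₂ J₂ : ℝ} (h₁ : NormalB k₁ H₁ I₁ J₁)
    (h₂ : NormalB k₂ H₂ I₂ J₂)
    (h : FunEquiv (cubicFun 1 0 (-1) 0 0 0 (-k₁) H₁ I₁ J₁)
      (cubicFun 1 0 (-1) 0 0 0 (-k₂) H₂ I₂ J₂)) :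
    k₁ = k₂ ∧ H₁ = H₂ ∧ I₁ = I₂ ∧ J₁ = J₂ := by
  obtain ⟨z, a₁, a₂, hz, hk, ha₁, ha₂, hJ, hHI⟩ := funEquiv_B h
  have hz2 : 0 < z ^ 2 := by positivity
  have hz3 : z ^ 3 ≠ 0 := pow_ne_zero 3 hz
  rcases h₁ with ⟨rfl, hI₁, hHI₁⟩ | ⟨rfl, rfl, hJ₁, hl₁, hu₁⟩ | ⟨rfl, rfl, rfl, hJ₁⟩ <;>
  rcases h₂ with ⟨rfl, hI₂, hHI₂⟩ | ⟨rfl, rfl, hJ₂, hl₂, hu₂⟩ | ⟨rfl, rfl, rfl, hJ₂⟩ <;>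
  try (simp [hz.symm] at hk; done)
  · obtain rfl : z = 1 := by linarith
    have hH : a₁ = a₂ ∧ I₁ = I₂ := by
      rcases hHI with ⟨h, h' | h'⟩ | ⟨h, h' | h'⟩ | ⟨h, h' | h'⟩ <;> constructor <;> linarith
    obtain ⟨hH, rfl⟩ := hH
    obtain rfl : H₁ = H₂ := by linarith
    exact ⟨rfl, rfl, rfl, by linarith⟩
  · obtain rfl : H₁ = a₁ := by linarith
    obtain rfl : H₂ = a₂ := by linarith
    have hl : -(z ^ 2) ≤ z ^ 2 * H₂ := by nlinarith
    have hu : z ^ 2 * H₂ ≤ z ^ 2 := by nlinarith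
    have hz1 : z ^ 2 = 1 := by
      rcases hHI with ⟨h, h' | h'⟩ | ⟨h, h' | h'⟩ | ⟨h, h' | h'⟩ <;> linarith
    rw [hz1] at hHI
    have hH : H₁ = H₂ := by
      rcases hHI with ⟨h, h' | h'⟩ | ⟨h, h' | h'⟩ | ⟨h, h' | h'⟩ <;> linarith
    exact ⟨rfl, hH, rfl, eq_of_sq_eq_one hz1 hJ₁ hJ₂ (by linear_combination hJ)⟩
  · exfalso
    rcases hHI with ⟨h, h' | h'⟩ | ⟨h, h' | h'⟩ | ⟨h, h' | h'⟩ <;>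
      simp only [ha₁, ha₂] at h h' <;> linarith
  · exfalso
    obtain rfl : H₂ = a₂ := by linarith
    obtain rfl : 0 = a₁ := by linarith
    have hl : -(z ^ 2) ≤ z ^ 2 * H₂ := by nlinarith
    have hu : z ^ 2 * H₂ ≤ z ^ 2 := by nlinarith
    rcases hHI with ⟨h, h' | h'⟩ | ⟨h, h' | h'⟩ | ⟨h, h' | h'⟩ <;> linarith
  · exact ⟨rfl, rfl, rfl, eq_of_eq_scale hz3 one_ne_zero hJ₁ hJ₂ (by linear_combination hJ)⟩

lemma funEquiv_C {k₁ H₁ I₁ J₁ k₂ H₂ I₂ J₂ : ℝ}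
    (h : FunEquiv (cubicFun 0 1 0 0 0 0 k₁ H₁ I₁ J₁) (cubicFun 0 1 0 0 0 0 k₂ H₂ I₂ J₂)) :
    ∃ a b : ℝ, a ≠ 0 ∧ b ≠ 0 ∧ b * k₁ = a ^ 2 * k₂ ∧ H₁ = a * b * H₂ ∧ I₁ = a ^ 2 * I₂ ∧
      J₁ = a ^ 2 * b * J₂ := by
  obtain ⟨p, q, r, s, t, u, k, hd, hk, ⟨c1, c2, c3, c4⟩, ⟨d1, d2, d3⟩, l1, l2, l3⟩ := h.coeff_eq
  have hp : p ≠ 0 := by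
    rintro rfl
    exact hk (by linear_combination -c2)
  obtain rfl : s = 0 := by
    have : p ^ 2 * s = 0 := by linear_combination c1
    exact (mul_eq_zero.mp this).resolve_left (pow_ne_zero 2 hp)
  have ht : t ≠ 0 := by rintro rfl; simp at hd
  obtain rfl : q = 0 := by
    have : (p * t) * q = 0 := by linear_combination c3 / 2
    exact (mul_eq_zero.mp this).resolve_left (mul_ne_zero hp ht)
  obtain rfl : k = p ^ 2 * t := by linear_combination -c2
  obtain rfl : u = 0 := by
    have : p ^ 2 * u = 0 := by linear_combination d1
    exact (mul_eq_zero.mp this).resolve_left (pow_ne_zero 2 hp)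
  obtain rfl : r = 0 := by
    have : (p * t) * r = 0 := by linear_combination d2 / 2
    exact (mul_eq_zero.mp this).resolve_left (mul_ne_zero hp ht)
  exact ⟨p, t, hp, ht, mul_left_cancel₀ ht (by linear_combination d3),
    mul_left_cancel₀ hp (by linear_combination l1),
    mul_left_cancel₀ ht (by linear_combination l2), by linear_combination l3⟩

lemma normalC_unique {k₁ H₁ I₁ J₁ k₂ H₂ I₂ J₂ : ℝ} (h₁ : NormalC k₁ H₁ I₁ J₁)
    (h₂ : NormalC k₂ H₂ I₂ J₂)
    (h : FunEquiv (cubicFun 0 1 0 0 0 0 k₁ H₁ I₁ J₁) (cubicFun 0 1 0 0 0 0 k₂ H₂ I₂ J₂)) :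
    k₁ = k₂ ∧ H₁ = H₂ ∧ I₁ = I₂ ∧ J₁ = J₂ := by
  obtain ⟨a, b, ha, hb, hk, hH, hI, hJ⟩ := funEquiv_C h
  have ha2 : 0 < a ^ 2 := by positivity
  have hab : a * b ≠ 0 := mul_ne_zero ha hb
  have ha2b : a ^ 2 * b ≠ 0 := mul_ne_zero ha2.ne' hb
  rcases h₁ with ⟨rfl, rfl⟩ | ⟨rfl, rfl, hI₁⟩ | ⟨rfl, rfl, rfl, hJ₁⟩ | ⟨rfl, rfl, hI₁, hJ₁⟩ |
    ⟨rfl, rfl, hI₁, hJ₁⟩ | ⟨rfl, rfl, rfl, hJ₁⟩ | ⟨rfl, rfl, rfl, hJ₁⟩ <;>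
  rcases h₂ with ⟨rfl, rfl⟩ | ⟨rfl, rfl, hI₂⟩ | ⟨rfl, rfl, rfl, hJ₂⟩ | ⟨rfl, rfl, hI₂, hJ₂⟩ |
    ⟨rfl, rfl, hI₂, hJ₂⟩ | ⟨rfl, rfl, rfl, hJ₂⟩ | ⟨rfl, rfl, rfl, hJ₂⟩ <;>
  try (first
    | (simp [hb] at hk; done)
    | (replace hk := hk.symm; simp [ha] at hk; done)
    | (simp [ha, hb] at hH; done)
    | exact absurd hI (sign_ne_scale_zero ‹_›)
    | exact absurd hI (zero_ne_scale_sign ha2.ne' ‹_›))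
  · obtain rfl : b = a ^ 2 := by linarith
    obtain rfl : a = 1 := by
      have h3 : a ^ 3 = 1 := by linear_combination hH
      nlinarith [sq_nonneg (a + 1), mul_eq_zero.mp (show (a - 1) * (a ^ 2 + a + 1) = 0 by
        linear_combination h3)]
    exact ⟨rfl, rfl, by linarith, by linarith⟩
  · obtain rfl : b = a ^ 2 := by linarith
    obtain ⟨hI', h1⟩ := sign_unique ha2 hI₁ hI₂ hI
    exact ⟨rfl, rfl, hI', by rw [hJ, h1]; ring⟩
  · obtain rfl : b = a ^ 2 := by linarith
    refine ⟨rfl, rfl, rfl, ?_⟩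
    have h4 : 0 < a ^ 2 * a ^ 2 := by positivity
    rcases hJ₁ with hJ₁ | rfl <;> rcases hJ₂ with hJ₂ | rfl
    · exact (sign_unique h4 hJ₁ hJ₂ hJ).1
    · exact absurd hJ (sign_ne_scale_zero hJ₁)
    · exact absurd hJ (zero_ne_scale_sign h4.ne' hJ₂)
    · rfl
  · obtain ⟨hI', h1⟩ := sign_unique ha2 hI₁ hI₂ hI
    have hab1 : a * b = 1 := by linarith
    refine ⟨rfl, rfl, hI', eq_of_sq_eq_one h1 hJ₁ hJ₂ ?_⟩
    linear_combination hJ + a * J₂ * hab1 - a * J₂ * h1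
  · obtain ⟨hI', -⟩ := sign_unique ha2 hI₁ hI₂ hI
    exact ⟨rfl, rfl, hI', eq_of_eq_scale ha2b one_ne_zero hJ₁ hJ₂ hJ⟩
  · exact ⟨rfl, rfl, rfl, eq_of_eq_scale ha2b one_ne_zero hJ₁ hJ₂ hJ⟩
  · exact ⟨rfl, rfl, rfl, eq_of_eq_scale ha2b (by norm_num) hJ₁ hJ₂ hJ⟩

lemma funEquiv_D {m₁ n₁ H₁ I₁ J₁ m₂ n₂ H₂ I₂ J₂ : ℝ}
    (h : FunEquiv (cubicFun 1 0 0 0 0 m₁ n₁ H₁ I₁ J₁) (cubicFun 1 0 0 0 0 m₂ n₂ H₂ I₂ J₂)) :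
    ∃ p r s t u : ℝ, p ≠ 0 ∧ t ≠ 0 ∧
      3 * p ^ 2 * r + m₁ * p * s + n₁ * s ^ 2 = 0 ∧
      m₁ * p * t + 2 * n₁ * s * t = p ^ 3 * m₂ ∧
      n₁ * t ^ 2 = p ^ 3 * n₂ ∧
      3 * p * r ^ 2 + m₁ * (p * u + r * s) + 2 * n₁ * s * u + H₁ * p + I₁ * s = p ^ 3 * H₂ ∧
      m₁ * r * t + 2 * n₁ * t * u + I₁ * t = p ^ 3 * I₂ ∧
      r ^ 3 + m₁ * (r * u) + n₁ * u ^ 2 + H₁ * r + I₁ * u + J₁ = p ^ 3 * J₂ := by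
  obtain ⟨p, q, r, s, t, u, k, hd, hk, ⟨c1, c2, c3, c4⟩, ⟨d1, d2, d3⟩, l1, l2, l3⟩ := h.coeff_eq
  obtain rfl : q = 0 := pow_eq_zero_iff (n := 3) (by norm_num) |>.mp (by linear_combination c4)
  obtain rfl : k = p ^ 3 := by linear_combination -c1
  have hp : p ≠ 0 := by rintro rfl; simp at hd
  have ht : t ≠ 0 := by rintro rfl; simp at hd
  exact ⟨p, r, s, t, u, hp, ht, by linear_combination d1, by linear_combination d2,
    by linear_combination d3, by linear_combination l1, by linear_combination l2,
    by linear_combination l3⟩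

lemma normalD_unique {m₁ n₁ H₁ I₁ J₁ m₂ n₂ H₂ I₂ J₂ : ℝ} (h₁ : NormalD m₁ n₁ H₁ I₁ J₁)
    (h₂ : NormalD m₂ n₂ H₂ I₂ J₂)
    (h : FunEquiv (cubicFun 1 0 0 0 0 m₁ n₁ H₁ I₁ J₁) (cubicFun 1 0 0 0 0 m₂ n₂ H₂ I₂ J₂)) :
    m₁ = m₂ ∧ n₁ = n₂ ∧ H₁ = H₂ ∧ I₁ = I₂ ∧ J₁ = J₂ := by
  obtain ⟨p, r, s, t, u, hp, ht, hr, hm, hn, hH, hI, hJ⟩ := funEquiv_D h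
  have hp2 : 0 < p ^ 2 := by positivity
  have hp3 : p ^ 3 ≠ 0 := pow_ne_zero 3 hp
  have key : m₁ = 0 → n₁ = -1 → n₂ = -1 → m₂ = 0 → I₁ = 0 → I₂ = 0 →
      0 < p ∧ H₁ = p ^ 2 * H₂ ∧ J₁ = p ^ 3 * J₂ := by
    rintro rfl rfl rfl rfl rfl rfl
    have hp : 0 < p := by
      by_contra! h
      have : 0 < t ^ 2 := by positivity
      nlinarith
    obtain rfl : s = 0 := mul_left_cancel₀ ht (by linear_combination -hm / 2)
    obtain rfl : r = 0 := mul_left_cancel₀ hp2.ne' (by linear_combination hr / 3)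
    obtain rfl : u = 0 := mul_left_cancel₀ ht (by linear_combination -hI / 2)
    exact ⟨hp, mul_left_cancel₀ hp.ne' (by linear_combination hH), by linear_combination hJ⟩
  have key' : m₁ = 0 → n₁ = 0 → I₁ = 0 → H₁ = p ^ 2 * H₂ ∧ J₁ = p ^ 3 * J₂ := by
    rintro rfl rfl rfl
    obtain rfl : r = 0 := mul_left_cancel₀ hp2.ne' (by linear_combination hr / 3)
    exact ⟨mul_left_cancel₀ hp (by linear_combination hH), by linear_combination hJ⟩
  rcases h₁ with ⟨rfl, rfl, rfl, hH₁⟩ | ⟨rfl, rfl, rfl, rfl, hJ₁⟩ | ⟨rfl, rfl, rfl, rfl, rfl⟩ |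
    ⟨rfl, rfl, rfl, rfl, hJ₁⟩ | ⟨rfl, rfl, rfl, hH₁, hJ₁⟩ | ⟨rfl, rfl, rfl, rfl, hJ₁⟩ <;>
  rcases h₂ with ⟨rfl, rfl, rfl, hH₂⟩ | ⟨rfl, rfl, rfl, rfl, hJ₂⟩ | ⟨rfl, rfl, rfl, rfl, rfl⟩ |
    ⟨rfl, rfl, rfl, rfl, hJ₂⟩ | ⟨rfl, rfl, rfl, hH₂, hJ₂⟩ | ⟨rfl, rfl, rfl, rfl, hJ₂⟩ <;>
  try (first
    | (simp [hp, ht] at hn; done)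
    | (simp [hp, ht] at hm; done)
    | (simp [hp, ht] at hI; done))
  · obtain ⟨hp0, hH', hJ'⟩ := key rfl rfl rfl rfl rfl rfl
    obtain ⟨hHH, h1⟩ := sign_unique hp2 hH₁ hH₂ hH'
    obtain rfl : p = 1 := by nlinarith
    exact ⟨rfl, rfl, hHH, rfl, by linarith⟩
  · exact absurd (key rfl rfl rfl rfl rfl rfl).2.1 (sign_ne_scale_zero hH₁)
  · exact absurd (key rfl rfl rfl rfl rfl rfl).2.1 (zero_ne_scale_sign hp2.ne' hH₂)
  · obtain ⟨hp0, -, hJ'⟩ := key rfl rfl rfl rfl rfl rfl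
    refine ⟨rfl, rfl, rfl, rfl, ?_⟩
    have hp3 : 0 < p ^ 3 := by positivity
    rcases hJ₁ with hJ₁ | rfl <;> rcases hJ₂ with hJ₂ | rfl
    · exact (sign_unique hp3 hJ₁ hJ₂ hJ').1
    · exact absurd hJ' (sign_ne_scale_zero hJ₁)
    · exact absurd hJ' (zero_ne_scale_sign hp3.ne' hJ₂)
    · rfl
  · exact ⟨rfl, rfl, rfl, rfl, rfl⟩
  · obtain rfl : r = 0 := by simpa [ht] using hI
    refine ⟨rfl, rfl, rfl, rfl, eq_of_eq_scale hp3 one_ne_zero hJ₁ hJ₂ ?_⟩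
    linear_combination hJ
  · obtain ⟨hH', hJ'⟩ := key' rfl rfl rfl
    obtain ⟨hHH, h1⟩ := sign_unique hp2 hH₁ hH₂ hH'
    exact ⟨rfl, rfl, hHH, rfl, eq_of_sq_eq_one h1 hJ₁ hJ₂ hJ'⟩
  · exact absurd (key' rfl rfl rfl).1 (sign_ne_scale_zero hH₁)
  · exact absurd (key' rfl rfl rfl).1 (zero_ne_scale_sign hp2.ne' hH₂)
  · exact ⟨rfl, rfl, rfl, rfl, eq_of_eq_scale hp3 one_ne_zero hJ₁ hJ₂ (key' rfl rfl rfl).2⟩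

/-- The discriminant of the binary cubic form `a·x³ + b·x²·y + c·x·y² + d·y³`. -/
def cubicFormDisc (a b c d : ℝ) : ℝ :=
  b ^ 2 * c ^ 2 - 4 * a * c ^ 3 - 4 * b ^ 3 * d - 27 * a ^ 2 * d ^ 2 + 18 * a * b * c * d

lemma FunEquiv.disc_eq {a b c d e f g h i j a' b' c' d' e' f' g' h' i' j' : ℝ}
    (H : FunEquiv (cubicFun a b c d e f g h i j) (cubicFun a' b' c' d' e' f' g' h' i' j')) :
    ∃ m : ℝ, 0 < m ∧ cubicFormDisc a b c d = m * cubicFormDisc a' b' c' d' := by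
  obtain ⟨p, q, r, s, t, u, k, hd, hk, ⟨c1, c2, c3, c4⟩, -, -⟩ := H.coeff_eq
  have hk4 : k ^ 4 * cubicFormDisc a' b' c' d' =
      (p * t - q * s) ^ 6 * cubicFormDisc a b c d := by
    have : k ^ 4 * cubicFormDisc a' b' c' d' =
        cubicFormDisc (k * a') (k * b') (k * c') (k * d') := by
      simp only [cubicFormDisc]
      ring
    rw [this, ← c1, ← c2, ← c3, ← c4]
    simp only [cubicFormDisc]
    ring
  have h6 : 0 < (p * t - q * s) ^ 6 := by positivity
  refine ⟨k ^ 4 / (p * t - q * s) ^ 6, by positivity, ?_⟩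
  field_simp
  linear_combination -hk4

lemma not_funEquiv_D_C {e f g h i j e' f' g' h' i' j' : ℝ} :
    ¬ FunEquiv (cubicFun 1 0 0 0 e f g h i j) (cubicFun 0 1 0 0 e' f' g' h' i' j') := by
  intro H
  obtain ⟨p, q, r, s, t, u, k, hd, hk, ⟨c1, c2, c3, c4⟩, -, -⟩ := H.coeff_eq
  have hp : p = 0 := pow_eq_zero_iff (n := 3) (by norm_num) |>.mp (by linear_combination c1)
  have hq : q = 0 := pow_eq_zero_iff (n := 3) (by norm_num) |>.mp (by linear_combination c4)
  simp [hp, hq] at hd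

lemma not_funEquiv_C_D {e f g h i j e' f' g' h' i' j' : ℝ} :
    ¬ FunEquiv (cubicFun 0 1 0 0 e f g h i j) (cubicFun 1 0 0 0 e' f' g' h' i' j') := by
  intro H
  obtain ⟨p, q, r, s, t, u, k, hd, hk, ⟨c1, c2, c3, c4⟩, -, -⟩ := H.coeff_eq
  have hp : p ≠ 0 := by
    rintro rfl
    exact hk (by linear_combination -c1)
  have hqt : q ^ 2 * t = 0 := by linear_combination c4
  have hq : q = 0 := by
    rcases mul_eq_zero.mp hqt with h | rfl
    · exact pow_eq_zero_iff (n := 2) (by norm_num) |>.mp h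
    · simp at hd
      by_contra hq
      have : p * q * s = 0 := by linear_combination c2 / 2
      simp_all
  subst hq
  have : p ^ 2 * t = 0 := by linear_combination c2
  simp_all

theorem stmt8 :
    (∀ f : P2, f.totalDegree = 3 → ∃ g : P2, InTable g ∧ AffEquiv f g) ∧
    (∀ g₁ g₂ : P2, InTable g₁ → InTable g₂ → g₁ ≠ g₂ → ¬ AffEquiv g₁ g₂) := by
  refine ⟨fun f hf => exists_table_affEquiv hf, fun g₁ g₂ h₁ h₂ hne hequiv => ?_⟩
  simp only [InTable, famA_iff, famB_iff, famC_iff, famD_iff] at h₁ h₂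
  rcases h₁ with ⟨k₁, H₁, I₁, J₁, h₁, rfl⟩ | ⟨k₁, H₁, I₁, J₁, h₁, rfl⟩ |
    ⟨k₁, H₁, I₁, J₁, h₁, rfl⟩ | ⟨m₁, n₁, H₁, I₁, J₁, h₁, rfl⟩ <;>
  rcases h₂ with ⟨k₂, H₂, I₂, J₂, h₂, rfl⟩ | ⟨k₂, H₂, I₂, J₂, h₂, rfl⟩ |
    ⟨k₂, H₂, I₂, J₂, h₂, rfl⟩ | ⟨m₂, n₂, H₂, I₂, J₂, h₂, rfl⟩ <;>
  rw [affEquiv_cubicPoly_iff] at hequiv <;>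
  obtain ⟨m, hm, hdisc⟩ := hequiv.disc_eq <;>
  norm_num [cubicFormDisc] at hdisc <;>
  try (exfalso; linarith)
  · obtain ⟨rfl, rfl, rfl, rfl⟩ := normalA_unique h₁ h₂ hequiv
    exact hne rfl
  · obtain ⟨rfl, rfl, rfl, rfl⟩ := normalB_unique h₁ h₂ hequiv
    exact hne rfl
  · obtain ⟨rfl, rfl, rfl, rfl⟩ := normalC_unique h₁ h₂ hequiv
    exact hne rfl
  · exact not_funEquiv_C_D hequiv
  · exact not_funEquiv_D_C hequiv
  · obtain ⟨rfl, rfl, rfl, rfl, rfl⟩ := normalD_unique h₁ h₂ hequiv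
    exact hne rfl
end

section
/- If φ is a ring automorphism of ℝ[x,y], c is a nonzero real number, and g ∈ ℝ[x,y] satisfies φ(x² + y²) = c·g, then the total degree of g is at least 2. Consequently, AutDeg(x² + y²) = 2. -/
open MvPolynomial

/-- `AutDeg f` : the minimal total degree of a polynomial `g` with `g ≈ f`. -/
noncomputable def AutDeg (f : P2) : ℕ :=
  sInf {n : ℕ | ∃ g : P2, AutEquiv g f ∧ g.totalDegree = n}

/-- A polynomial of total degree at most one is affine. -/
lemma MvPolynomial.eq_C_add_sum_of_totalDegree_le_one {σ R : Type*} [Fintype σ] [CommSemiring R]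
    {p : MvPolynomial σ R} (hp : p.totalDegree ≤ 1) :
    p = C (p.coeff 0) + ∑ i, C (p.coeff (Finsupp.single i 1)) * X i := by
  classical
  ext m
  simp only [coeff_add, coeff_C, coeff_sum, coeff_C_mul, coeff_X, mul_ite, mul_one, mul_zero]
  by_cases h0 : m = 0
  · subst h0
    simp
  rw [if_neg (Ne.symm h0), zero_add]
  by_cases h1 : ∃ i, Finsupp.single i 1 = m
  · obtain ⟨i, rfl⟩ := h1
    simp [Finsupp.single_left_inj]
  · rw [Finset.sum_eq_zero fun i _ => if_neg fun h => h1 ⟨i, h⟩]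
    obtain ⟨i, hi⟩ := Finsupp.ne_iff.mp h0
    obtain ⟨n, rfl⟩ : ∃ n, m = Finsupp.single i 1 + n :=
      ⟨m - Finsupp.single i 1, (add_tsub_cancel_of_le
        (Finsupp.single_le_iff.mpr (Nat.one_le_iff_ne_zero.mpr hi))).symm⟩
    apply coeff_eq_zero_of_totalDegree_lt
    refine hp.trans_lt ?_
    have hn : n ≠ 0 := fun h => h1 ⟨i, by simp [h]⟩
    have hpos : n.degree ≠ 0 := fun h => hn ((Finsupp.degree_eq_zero_iff n).mp h)
    change 1 < (Finsupp.single i 1 + n).degree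
    rw [map_add, Finsupp.degree_single]
    omega

/-- A real polynomial of total degree at most one taking only nonnegative values is constant. -/
lemma MvPolynomial.eq_C_of_totalDegree_le_one_of_eval_nonneg {σ : Type*} [Fintype σ]
    {p : MvPolynomial σ ℝ} (hp : p.totalDegree ≤ 1) (hpos : ∀ v, 0 ≤ eval v p) :
    p = C (p.coeff 0) := by
  classical
  have hcoeff : ∀ i, p.coeff (Finsupp.single i 1) = 0 := by
    intro i
    by_contra hb
    set v : σ → ℝ := Pi.single i (-(p.coeff 0 + 1) / p.coeff (Finsupp.single i 1)) with hv
    have h := hpos v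
    have heval := congrArg (eval v) (eq_C_add_sum_of_totalDegree_le_one hp)
    simp only [map_add, map_sum, map_mul, eval_C, eval_X, hv, Pi.single_apply, mul_ite, mul_zero,
      Finset.sum_ite_eq', Finset.mem_univ, if_true, mul_div_cancel₀ _ hb] at heval
    rw [← hv] at heval
    linarith
  conv_lhs => rw [eq_C_add_sum_of_totalDegree_le_one hp]
  simp [hcoeff]

lemma totalDegree_X_sq_add_X_sq_le : (X 0 ^ 2 + X 1 ^ 2 : P2).totalDegree ≤ 2 := by
  refine (totalDegree_add _ _).trans ?_
  simp [totalDegree_X_pow]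

/-- The sum of squares of the variables is not a constant. -/
lemma X_sq_add_X_sq_ne_C (a : ℝ) : (X 0 ^ 2 + X 1 ^ 2 : P2) ≠ C a := by
  intro h
  have h0 := congrArg (eval (0 : Fin 2 → ℝ)) h
  have h1 := congrArg (eval (1 : Fin 2 → ℝ)) h
  simp at h0 h1
  linarith

/-- Ring automorphisms of `ℝ[x,y]` send nonzero constants to nonzero constants. -/
lemma exists_map_C_eq_C (φ : P2 ≃+* P2) {c : ℝ} (hc : c ≠ 0) :
    ∃ d : ℝ, d ≠ 0 ∧ φ (C c) = C d := by
  have hu : IsUnit (φ (C c)) := ((isUnit_iff_ne_zero.mpr hc).map C).map φ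
  obtain ⟨d, hd, h⟩ := isUnit_iff_eq_C_of_isReduced.mp hu
  exact ⟨d, hd.ne_zero, h⟩

lemma two_le_totalDegree_map (φ : P2 ≃+* P2) :
    2 ≤ (φ (X 0 ^ 2 + X 1 ^ 2)).totalDegree := by
  by_contra! hlt
  have hconst := eq_C_of_totalDegree_le_one_of_eval_nonneg (Nat.le_of_lt_succ hlt) fun v => by
    simp only [map_add, map_pow]
    positivity
  set a := (φ (X 0 ^ 2 + X 1 ^ 2)).coeff 0
  have hsymm := (RingEquiv.eq_symm_apply φ).mpr hconst
  by_cases ha : a = 0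
  · rw [ha, map_zero, map_zero, ← C_0] at hsymm
    exact X_sq_add_X_sq_ne_C 0 hsymm
  · obtain ⟨d, -, hd⟩ := exists_map_C_eq_C φ.symm ha
    exact X_sq_add_X_sq_ne_C d (hsymm.trans hd)

lemma totalDegree_C_mul_le (c : ℝ) (g : P2) : (C c * g).totalDegree ≤ g.totalDegree := by
  simpa using totalDegree_mul (C c) g

theorem stmt9 :
    (∀ (φ : P2 ≃+* P2) (c : ℝ) (g : P2), c ≠ 0 →
      φ (X 0 ^ 2 + X 1 ^ 2) = C c * g → 2 ≤ g.totalDegree) ∧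
    AutDeg (X 0 ^ 2 + X 1 ^ 2) = 2 := by
  have lower : ∀ (φ : P2 ≃+* P2) (c : ℝ) (g : P2), c ≠ 0 →
      φ (X 0 ^ 2 + X 1 ^ 2) = C c * g → 2 ≤ g.totalDegree := fun φ c g _ h =>
    ((two_le_totalDegree_map φ).trans_eq (congrArg totalDegree h)).trans
      (totalDegree_C_mul_le c g)
  refine ⟨lower, ?_⟩
  have hmem : 2 ∈ {n : ℕ | ∃ g : P2, AutEquiv g (X 0 ^ 2 + X 1 ^ 2) ∧ g.totalDegree = n} :=
    ⟨X 0 ^ 2 + X 1 ^ 2, ⟨RingEquiv.refl _, 1, one_ne_zero, by simp⟩,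
      totalDegree_X_sq_add_X_sq_le.antisymm (two_le_totalDegree_map (RingEquiv.refl _))⟩
  refine (Nat.sInf_le hmem).antisymm (le_csInf ⟨2, hmem⟩ ?_)
  rintro n ⟨g, ⟨φ, c, hc, h⟩, rfl⟩
  obtain ⟨d, hd, hCd⟩ := exists_map_C_eq_C φ.symm hc
  have hg : C d * φ.symm (X 0 ^ 2 + X 1 ^ 2) = g := by
    rw [← hCd, ← map_mul, ← h, RingEquiv.symm_apply_apply]
  refine lower φ.symm d⁻¹ g (inv_ne_zero hd) ?_
  rw [← hg, ← mul_assoc, ← C_mul, inv_mul_cancel₀ hd, C_1, one_mul]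
end

section
/- Let f and g each belong to the following family of polynomials in ℝ[x,y]: x³ + x·y² + x² + H·x + I·y + J with H, J ∈ ℝ and I ≥ 0; x³ + x·y² + y + H·x + J with H ∈ ℝ and J ≥ 0; x³ + x·y² + ε·x + J with ε ∈ {1, −1} and J ≥ 0; x³ + x·y² + 1; x³ + x·y². If f ≈ g, then f = g. -/
open MvPolynomial

theorem ringEquiv_C {σ : Type*} (φ : MvPolynomial σ ℝ ≃+* MvPolynomial σ ℝ) (r : ℝ) :
    φ (C r) = C r := by
  have key : ∀ r : ℝ, ∃ s : ℝ, φ (C r) = C s := by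
    intro r
    by_cases hr : r = 0
    · exact ⟨0, by simp [hr]⟩
    · have hu : IsUnit (φ (C r)) := ((IsUnit.mk0 r hr).map C).map φ
      obtain ⟨s, -, hs⟩ := isUnit_iff_eq_C_of_isReduced.1 hu
      exact ⟨s, hs⟩
  have h : constantCoeff.comp ((φ : MvPolynomial σ ℝ →+* MvPolynomial σ ℝ).comp C)
      = RingHom.id ℝ := Subsingleton.elim _ _
  obtain ⟨s, hs⟩ := key r
  have h' := RingHom.congr_fun h r
  simp only [RingHom.comp_apply, RingHom.coe_coe, hs, constantCoeff_C, RingHom.id_apply] at h'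
  rw [hs, h']

theorem two_mul_totalDegree_le_sq_add_sq {σ : Type*} [LinearOrder σ] [WellFoundedGT σ]
    (P Q : MvPolynomial σ ℝ) :
    2 * P.totalDegree ≤ (P ^ 2 + Q ^ 2).totalDegree ∧
      2 * Q.totalDegree ≤ (P ^ 2 + Q ^ 2).totalDegree := by
  have key : ∀ P Q : MvPolynomial σ ℝ,
      MonomialOrder.degLex.toSyn (MonomialOrder.degLex.degree Q) ≤
        MonomialOrder.degLex.toSyn (MonomialOrder.degLex.degree P) →
      2 * P.totalDegree ≤ (P ^ 2 + Q ^ 2).totalDegree ∧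
      2 * Q.totalDegree ≤ (P ^ 2 + Q ^ 2).totalDegree := by
    intro P Q h
    have hQP := degLex_totalDegree_monotone h
    suffices h2 : 2 * P.totalDegree ≤ (P ^ 2 + Q ^ 2).totalDegree from ⟨h2, by omega⟩
    by_cases hP : P = 0
    · simp [hP]
    have hlc : MonomialOrder.degLex.leadingCoeff P ≠ 0 :=
      MonomialOrder.degLex.leadingCoeff_ne_zero_iff.2 hP
    have hQ : 0 ≤ coeff (2 • MonomialOrder.degLex.degree P) (Q ^ 2) := by
      rcases h.eq_or_lt with h | h
      · rw [← MonomialOrder.degLex.toSyn.injective h, MonomialOrder.coeff_pow_nsmul_degree]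
        positivity
      · rw [MonomialOrder.coeff_eq_zero_of_lt (m := MonomialOrder.degLex)]
        rw [MonomialOrder.degree_pow, map_nsmul, map_nsmul]
        exact nsmul_lt_nsmul_right (by norm_num) h
    have hne : coeff (2 • MonomialOrder.degLex.degree P) (P ^ 2 + Q ^ 2) ≠ 0 := by
      rw [coeff_add, MonomialOrder.coeff_pow_nsmul_degree]
      positivity
    have hle := le_totalDegree (mem_support_iff.2 hne)
    have hd := degree_degLexDegree (f := P)
    rw [← hd]
    calc _ = (2 • MonomialOrder.degLex.degree P).degree := by simp [map_nsmul]
      _ ≤ _ := by rw [Finsupp.degree_apply]; simpa [Finsupp.sum] using hle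
  rcases le_total (MonomialOrder.degLex.toSyn (MonomialOrder.degLex.degree Q))
    (MonomialOrder.degLex.toSyn (MonomialOrder.degLex.degree P)) with h | h
  · exact key P Q h
  · have := key Q P h
    rw [add_comm (P ^ 2)]
    exact this.symm

theorem exists_affine_of_totalDegree_le_one {P : P2} (h : P.totalDegree ≤ 1) :
    ∃ a b r : ℝ, P = C a * X 0 + C b * X 1 + C r := by
  refine ⟨coeff (Finsupp.single 0 1) P, coeff (Finsupp.single 1 1) P, coeff 0 P, ?_⟩
  ext m
  have hm : m = Finsupp.single 0 (m 0) + Finsupp.single 1 (m 1) := by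
    ext i; fin_cases i <;> simp
  by_cases hdeg : m 0 + m 1 ≤ 1
  · have h3 : (m 0 = 0 ∧ m 1 = 0) ∨ (m 0 = 1 ∧ m 1 = 0) ∨ (m 0 = 0 ∧ m 1 = 1) := by omega
    rcases h3 with ⟨h0, h1⟩ | ⟨h0, h1⟩ | ⟨h0, h1⟩ <;> rw [h0, h1] at hm <;> subst hm <;>
      simp [coeff_C_mul, coeff_X, coeff_C, Finsupp.single_eq_single_iff,
        eq_comm (a := (0 : Fin 2 →₀ ℕ))]
  · have e0 : Finsupp.single 0 1 ≠ m := by rintro rfl; simp at hdeg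
    have e1 : Finsupp.single 1 1 ≠ m := by rintro rfl; simp at hdeg
    have e2 : 0 ≠ m := by rintro rfl; simp at hdeg
    rw [coeff_eq_zero_of_totalDegree_lt]
    · simp [coeff_C_mul, coeff_X, coeff_C, e0, e1, e2]
    · have : m.degree = m 0 + m 1 := by simp [Finsupp.degree_eq_sum]
      rw [Finsupp.degree_apply] at this
      omega

theorem cubic_coeffs_eq_zero {a b c d e f g h i j : ℝ}
    (H : ∀ u v : ℝ, a * u ^ 3 + b * u ^ 2 * v + c * u * v ^ 2 + d * v ^ 3 + e * u ^ 2 + f * u * v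
      + g * v ^ 2 + h * u + i * v + j = 0) :
    a = 0 ∧ b = 0 ∧ c = 0 ∧ d = 0 ∧ e = 0 ∧ f = 0 ∧ g = 0 ∧ h = 0 ∧ i = 0 ∧ j = 0 := by
  have h1 := H 0 0
  have h2 := H 1 0
  have h3 := H (-1) 0
  have h4 := H 2 0
  have h5 := H 0 1
  have h6 := H 0 (-1)
  have h7 := H 0 2
  have h8 := H 1 1
  have h9 := H 1 (-1)
  have h10 := H (-1) 1
  norm_num at h1 h2 h3 h4 h5 h6 h7 h8 h9 h10
  refine ⟨?_, ?_, ?_, ?_, ?_, ?_, ?_, ?_, ?_, ?_⟩ <;> linarith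

/-- The cubic `x³ + xy² + Ex² + Hx + Iy + J`. -/
noncomputable def cubic (E H I J : ℝ) : P2 :=
  X 0 ^ 3 + X 0 * X 1 ^ 2 + C E * X 0 ^ 2 + C H * X 0 + C I * X 1 + C J

theorem totalDegree_image_le_one {E H I J E' H' I' J' k : ℝ} (φ : P2 ≃+* P2)
    (h : φ (cubic E H I J) = C k * cubic E' H' I' J') :
    (φ (X 0)).totalDegree ≤ 1 ∧ (φ (X 1)).totalDegree ≤ 1 := by
  have hP : 1 ≤ (φ (X 0)).totalDegree := by
    by_contra hlt
    have h0 := totalDegree_eq_zero_iff_eq_C.1 (show (φ (X 0)).totalDegree = 0 by omega)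
    rw [← ringEquiv_C φ] at h0
    have := congrArg totalDegree (φ.injective h0)
    simp at this
  simp only [cubic, map_add, map_mul, map_pow, ringEquiv_C] at h
  generalize φ (X 0) = P at *
  generalize φ (X 1) = Q at *
  obtain ⟨hp, hq⟩ := two_mul_totalDegree_le_sq_add_sq P Q
  have hP0 : P ≠ 0 := by rintro rfl; simp at hP
  have hS0 : P ^ 2 + Q ^ 2 ≠ 0 := by intro h0; rw [h0] at hp; simp at hp; simp [hp] at hP
  have hmul := totalDegree_mul_of_isDomain hP0 hS0
  have hC : ∀ (c : ℝ) (R : P2), (C c * R).totalDegree ≤ R.totalDegree := fun c R =>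
    (totalDegree_mul _ _).trans (by simp)
  have hadd : ∀ {R S : P2} {n : ℕ}, R.totalDegree ≤ n → S.totalDegree ≤ n →
      (R + S).totalDegree ≤ n := fun hR hS => (totalDegree_add _ _).trans (max_le hR hS)
  have hg : (C k * (X 0 ^ 3 + X 0 * X 1 ^ 2 + C E' * X 0 ^ 2 + C H' * X 0 + C I' * X 1 + C J')
      : P2).totalDegree ≤ 3 := by
    refine (hC _ _).trans (hadd (hadd (hadd (hadd (hadd ?_ ?_) ((hC _ _).trans ?_))
      ((hC _ _).trans ?_)) ((hC _ _).trans ?_)) ?_) <;> try simp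
    exact (totalDegree_mul _ _).trans (by simp)
  have hR : (C (-E) * P ^ 2 + C (-H) * P + C (-I) * Q + C (-J)).totalDegree ≤
      max (2 * P.totalDegree) Q.totalDegree :=
    hadd (hadd (hadd ((hC _ _).trans ((totalDegree_pow _ _).trans (le_max_left _ _)))
      ((hC _ _).trans (by omega))) ((hC _ _).trans (le_max_right _ _))) (by simp)
  have hsum := (totalDegree_add _ _).trans (max_le_max hg hR)
  have heq : P * (P ^ 2 + Q ^ 2) =
      C k * (X 0 ^ 3 + X 0 * X 1 ^ 2 + C E' * X 0 ^ 2 + C H' * X 0 + C I' * X 1 + C J') +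
        (C (-E) * P ^ 2 + C (-H) * P + C (-I) * Q + C (-J)) := by
    rw [← h]
    simp only [map_neg]
    ring
  rw [← heq, hmul] at hsum
  omega

theorem cubic_params_of_autEquiv {E H I J E' H' I' J' : ℝ}
    (h : AutEquiv (cubic E H I J) (cubic E' H' I' J')) :
    ∃ a d : ℝ, a ≠ 0 ∧ (d = a ∨ d = -a) ∧
      E = a * E' ∧ H = a ^ 2 * H' ∧ I * d = a ^ 3 * I' ∧ J = a ^ 3 * J' := by
  obtain ⟨φ, k, hk, h⟩ := h
  obtain ⟨hP, hQ⟩ := totalDegree_image_le_one φ h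
  obtain ⟨a, b, r, hP⟩ := exists_affine_of_totalDegree_le_one hP
  obtain ⟨c, d, s, hQ⟩ := exists_affine_of_totalDegree_le_one hQ
  simp only [cubic, map_add, map_mul, map_pow, ringEquiv_C, hP, hQ] at h
  have hev : ∀ u v : ℝ, (a * u + b * v + r) ^ 3 + (a * u + b * v + r) * (c * u + d * v + s) ^ 2
      + E * (a * u + b * v + r) ^ 2 + H * (a * u + b * v + r) + I * (c * u + d * v + s) + J
      = k * (u ^ 3 + u * v ^ 2 + E' * u ^ 2 + H' * u + I' * v + J') := by
    intro u v
    have := congrArg (eval ![u, v]) h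
    simpa using this
  have hb : b = 0 := by
    have h3 : b * (b ^ 2 + d ^ 2) = 0 := by
      have h0 := hev 0 0
      have h1 := hev 0 1
      have h2 := hev 0 (-1)
      have h4 := hev 0 2
      linear_combination (h4 - 3 * h1 - h2 + 3 * h0) / 6
    rcases mul_eq_zero.1 h3 with h | h
    · exact h
    · nlinarith [sq_nonneg b, sq_nonneg d]
  subst hb
  obtain ⟨h1, h2, h3, -, h5, h6, h7, h8, h9, h10⟩ := cubic_coeffs_eq_zero
    (a := a ^ 3 + a * c ^ 2 - k) (b := 2 * a * c * d) (c := a * d ^ 2 - k) (d := 0)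
    (e := 3 * a ^ 2 * r + 2 * a * c * s + r * c ^ 2 + E * a ^ 2 - k * E')
    (f := 2 * a * d * s + 2 * r * c * d) (g := r * d ^ 2)
    (h := 3 * a * r ^ 2 + a * s ^ 2 + 2 * r * c * s + 2 * E * a * r + H * a + I * c - k * H')
    (i := 2 * r * d * s + I * d - k * I')
    (j := r ^ 3 + r * s ^ 2 + E * r ^ 2 + H * r + I * s + J - k * J')
    (fun u v => by linear_combination hev u v)
  have ha : a ≠ 0 := by rintro rfl; apply hk; linarith
  have hd : d ≠ 0 := by rintro rfl; apply hk; linarith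
  obtain rfl : c = 0 := by simpa [ha, hd] using h2
  obtain rfl : r = 0 := by simpa [hd] using h7
  obtain rfl : s = 0 := by simpa [ha, hd] using h6
  obtain rfl : k = a ^ 3 := by linarith
  refine ⟨a, d, ha, sq_eq_sq_iff_eq_or_eq_neg.1 (mul_left_cancel₀ ha ?_),
    mul_left_cancel₀ (pow_ne_zero 2 ha) ?_, mul_left_cancel₀ ha ?_, ?_, ?_⟩ <;> linarith

/-- The parameters of `cubic` that occur in the table. -/
def IsNormalForm (E H I J : ℝ) : Prop :=
  (E = 1 ∧ 0 ≤ I) ∨ (E = 0 ∧ I = 1 ∧ 0 ≤ J) ∨ (E = 0 ∧ I = 0 ∧ (H = 1 ∨ H = -1) ∧ 0 ≤ J) ∨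
    (E = 0 ∧ I = 0 ∧ H = 0 ∧ (J = 1 ∨ J = 0))

theorem FamA.exists_cubic {p : P2} (hp : FamA p) :
    ∃ E H I J, IsNormalForm E H I J ∧ p = cubic E H I J := by
  rcases hp with ⟨H, I, J, hI, rfl⟩ | ⟨H, J, hJ, rfl⟩ | ⟨e, J, he, hJ, rfl⟩ | rfl | rfl
  · exact ⟨1, H, I, J, .inl ⟨rfl, hI⟩, by simp [cubic]⟩
  · exact ⟨0, H, 1, J, .inr (.inl ⟨rfl, rfl, hJ⟩), by simp [cubic]; ring⟩
  · exact ⟨0, e, 0, J, .inr (.inr (.inl ⟨rfl, rfl, he, hJ⟩)), by simp [cubic]⟩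
  · exact ⟨0, 0, 0, 1, .inr (.inr (.inr ⟨rfl, rfl, rfl, .inl rfl⟩)), by simp [cubic]⟩
  · exact ⟨0, 0, 0, 0, .inr (.inr (.inr ⟨rfl, rfl, rfl, .inr rfl⟩)), by simp [cubic]⟩

theorem eq_of_nonneg_of_eq_or_neg {s t : ℝ} (hs : 0 ≤ s) (ht : 0 ≤ t) (h : s = t ∨ s = -t) :
    s = t := by
  rcases h with h | h <;> linarith

theorem eq_of_eq_cube_mul {a s t : ℝ} (hs : 0 ≤ s) (ht : 0 ≤ t) (ha : a ^ 2 = 1)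
    (h : s = a ^ 3 * t) : s = t := by
  refine eq_of_nonneg_of_eq_or_neg hs ht ?_
  rcases sq_eq_sq_iff_eq_or_eq_neg.1 (ha.trans (one_pow 2).symm) with rfl | rfl
  · left; linarith
  · right; linarith

theorem IsNormalForm.params_eq {E H I J E' H' I' J' a d : ℝ} (hn : IsNormalForm E H I J)
    (hn' : IsNormalForm E' H' I' J') (ha : a ≠ 0) (hd : d = a ∨ d = -a)
    (hE : E = a * E') (hH : H = a ^ 2 * H') (hI : I * d = a ^ 3 * I') (hJ : J = a ^ 3 * J') :
    E = E' ∧ H = H' ∧ I = I' ∧ J = J' := by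
  have hd0 : d ≠ 0 := by rcases hd with rfl | rfl <;> simpa
  rcases hn with ⟨rfl, hI0⟩ | ⟨rfl, rfl, hJ0⟩ | ⟨rfl, rfl, hH0, hJ0⟩ | ⟨rfl, rfl, rfl, hJ0⟩ <;>
    rcases hn' with ⟨rfl, hI0'⟩ | ⟨rfl, rfl, hJ0'⟩ | ⟨rfl, rfl, hH0', hJ0'⟩ |
      ⟨rfl, rfl, rfl, hJ0'⟩ <;>
    simp [ha, hd0, eq_comm (a := (0 : ℝ))] at hE hI hH
  · subst hE
    refine ⟨rfl, by linarith, eq_of_nonneg_of_eq_or_neg hI0 hI0' ?_, by linarith⟩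
    rcases hd with rfl | rfl
    · left; linarith
    · right; linarith
  · have ha2 : a ^ 2 = 1 := by
      rcases hd with rfl | rfl
      · exact mul_left_cancel₀ ha (by linarith)
      · exact absurd (mul_left_cancel₀ ha (by linarith) : a ^ 2 = -1)
          (by nlinarith [sq_nonneg a])
    refine ⟨rfl, by rw [hH, ha2, one_mul], rfl, eq_of_eq_cube_mul hJ0 hJ0' ha2 hJ⟩
  · have ha2 : a ^ 2 = 1 := by
      rcases hH0 with rfl | rfl <;> rcases hH0' with rfl | rfl <;> nlinarith [sq_nonneg a]
    exact ⟨rfl, by rw [hH, ha2, one_mul], rfl, eq_of_eq_cube_mul hJ0 hJ0' ha2 hJ⟩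
  · rcases hH0 with h | h <;> linarith
  · rcases hH0' with h | h <;> linarith
  · refine ⟨rfl, rfl, rfl, ?_⟩
    rcases hJ0 with rfl | rfl <;> rcases hJ0' with rfl | rfl <;> simp [ha, eq_comm (a := (0 : ℝ))] at hJ ⊢

theorem stmt11 (f g : P2) (hf : FamA f) (hg : FamA g) (h : AutEquiv f g) :
    f = g := by
  obtain ⟨E, H, I, J, hn, rfl⟩ := hf.exists_cubic
  obtain ⟨E', H', I', J', hn', rfl⟩ := hg.exists_cubic
  obtain ⟨a, d, ha, hd, hE, hH, hI, hJ⟩ := cubic_params_of_autEquiv h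
  obtain ⟨rfl, rfl, rfl, rfl⟩ := hn.params_eq hn' ha hd hE hH hI hJ
  rfl
end

section
/- Let f and g each belong to the following family of polynomials in ℝ[x,y]: x²·y + y² − x + I·y + J with I, J ∈ ℝ; x²·y + y² + ε·y + J with ε ∈ {1, −1} and J ∈ ℝ; x²·y + y² + ε with ε ∈ {1, −1}; x²·y + y²; x²·y − x + ε·y + J with ε ∈ {1, −1} and J ≥ 0; x²·y + ε·y + 1 with ε ∈ {1, −1}; x²·y + ε·y with ε ∈ {1, −1}; x²·y − x + 1; x²·y − x; x²·y − 1; x²·y. If f ≈ g, then f = g. -/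
open MvPolynomial

/-- The common shape of all members of `FamC`. -/
noncomputable def cubicForm (s p r J : ℝ) : P2 :=
  X 0 ^ 2 * X 1 + C s * X 1 ^ 2 - C r * X 0 + C p * X 1 + C J

/-- The Poisson bracket on `ℝ[x,y]`, normalized so that `{y, x} = 1`. -/
noncomputable def poisson (a b : P2) : P2 :=
  pderiv 1 a * pderiv 0 b - pderiv 0 a * pderiv 1 b

theorem AutEquiv.symm {f g : P2} (h : AutEquiv f g) : AutEquiv g f := by
  obtain ⟨φ, c, hc, h⟩ := h
  have hu : IsUnit (φ.symm (C c)) := (hc.isUnit.map C).map φ.symm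
  obtain ⟨d, hd, hd'⟩ := isUnit_iff_eq_C_of_isReduced.mp hu
  refine ⟨φ.symm, d⁻¹, inv_ne_zero hd.ne_zero, ?_⟩
  have h1 : f = C d * φ.symm g := by
    rw [← hd', ← map_mul, ← h, RingEquiv.symm_apply_apply]
  rw [h1, ← mul_assoc, ← C_mul, inv_mul_cancel₀ hd.ne_zero, C_1, one_mul]

theorem ringEquiv_C_s13 (φ : P2 ≃+* P2) (a : ℝ) : φ (C a) = C a := by
  rcases eq_or_ne a 0 with rfl | ha
  · simp
  have hu : IsUnit (φ (C a)) := (ha.isUnit.map C).map φ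
  obtain ⟨b, -, hb⟩ := isUnit_iff_eq_C_of_isReduced.mp hu
  have h := DFunLike.congr_fun (Subsingleton.elim
    ((constantCoeff.comp (φ : P2 →+* P2)).comp C) (RingHom.id ℝ)) a
  simp only [RingHom.comp_apply, RingHom.coe_coe, hb, constantCoeff_C, RingHom.id_apply] at h
  rw [hb, h]

theorem pderiv_ringEquiv (φ : P2 ≃+* P2) (i : Fin 2) (a : P2) :
    pderiv i (φ a) =
      φ (pderiv 0 a) * pderiv i (φ (X 0)) + φ (pderiv 1 a) * pderiv i (φ (X 1)) := by
  induction a using MvPolynomial.induction_on with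
  | C r => simp [ringEquiv_C_s13]
  | add a b ha hb => simp only [map_add, ha, hb]; ring
  | mul_X a k ha =>
    have hX : pderiv i (φ (X k)) = φ (pderiv 0 (X k)) * pderiv i (φ (X 0))
        + φ (pderiv 1 (X k)) * pderiv i (φ (X 1)) := by
      fin_cases k <;> simp [pderiv_X]
    simp only [map_mul, pderiv_mul, map_add, ha] at hX ⊢
    rw [hX]
    ring

/-- A ring automorphism scales the Poisson bracket by its constant Jacobian determinant. -/
theorem exists_poisson_ringEquiv (φ : P2 ≃+* P2) :
    ∃ j : ℝ, j ≠ 0 ∧ ∀ a b, poisson (φ a) (φ b) = C j * φ (poisson a b) := by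
  have key (ψ : P2 ≃+* P2) (a b : P2) : poisson (ψ a) (ψ b) =
      -poisson (ψ (X 0)) (ψ (X 1)) * ψ (poisson a b) := by
    simp only [poisson, pderiv_ringEquiv ψ _ a, pderiv_ringEquiv ψ _ b, map_sub, map_mul]
    ring
  have h1 := key φ.symm (φ (X 0)) (φ (X 1))
  have hXX : poisson (X 0) (X 1) = -1 := by simp [poisson, pderiv_X]
  simp only [RingEquiv.symm_apply_apply, hXX] at h1
  have hu : IsUnit (φ.symm (poisson (φ (X 0)) (φ (X 1)))) :=
    IsUnit.of_mul_eq_one (poisson (φ.symm (X 0)) (φ.symm (X 1))) (by linear_combination h1)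
  have hu' : IsUnit (-poisson (φ (X 0)) (φ (X 1))) := by
    simpa using (hu.map φ).neg
  obtain ⟨j, hj, hj'⟩ := isUnit_iff_eq_C_of_isReduced.mp hu'
  exact ⟨j, hj.ne_zero, fun a b => by rw [key φ a b, hj']⟩

theorem totalDegree_mul_pderiv_le {u : P2} (hu : u.totalDegree ≤ 2) (i : Fin 2) (a : P2) :
    (u * pderiv i a).totalDegree ≤ a.totalDegree + 1 := by
  rcases eq_or_ne (pderiv i a) 0 with h0 | h0
  · simp [h0]
  have hlt : (pderiv i a).totalDegree + 1 ≤ a.totalDegree := by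
    obtain ⟨m, hm, hmd⟩ := Finset.exists_mem_eq_sup _ (support_nonempty.mpr h0)
      (fun m : Fin 2 →₀ ℕ => m.sum fun _ e => e)
    have hc : a.coeff (m + Finsupp.single i 1) ≠ 0 := by
      have := mem_support_iff.mp hm
      rw [coeff_pderiv] at this
      exact left_ne_zero_of_mul this
    have := le_totalDegree (mem_support_iff.mpr hc)
    rw [Finsupp.sum_add_index' (fun _ => rfl) (fun _ _ _ => rfl),
      Finsupp.sum_single_index rfl] at this
    rw [totalDegree, hmd]
    exact this
  have := totalDegree_mul u (pderiv i a)
  omega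

theorem pderiv_zero_cubicForm (s p r J : ℝ) :
    pderiv 0 (cubicForm s p r J) = C 2 * X 0 * X 1 - C r := by
  have h2 : (C 2 : P2) = 2 := map_ofNat C 2
  simp only [cubicForm, map_add, map_sub, pderiv_mul, pderiv_pow, pderiv_C]
  simp [pderiv_X, h2]

theorem pderiv_one_cubicForm (s p r J : ℝ) :
    pderiv 1 (cubicForm s p r J) = X 0 ^ 2 + C (2 * s) * X 1 + C p := by
  have h2 : (C 2 : P2) = 2 := map_ofNat C 2
  simp only [cubicForm, map_add, map_sub, pderiv_mul, pderiv_pow, pderiv_C]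
  simp [pderiv_X, h2]
  ring

theorem totalDegree_poisson_cubicForm_le (s p r J : ℝ) (a : P2) :
    (poisson (cubicForm s p r J) a).totalDegree ≤ a.totalDegree + 1 := by
  have hX (i : Fin 2) : (X i : P2).totalDegree = 1 := totalDegree_X i
  have h0 : (C 2 * X 0 * X 1 - C r : P2).totalDegree ≤ 2 := by
    refine (totalDegree_sub_C_le _ _).trans ((totalDegree_mul _ _).trans ?_)
    have := totalDegree_mul (C 2 : P2) (X 0)
    rw [hX, totalDegree_C] at this
    rw [hX]; omega
  have h1 : (X 0 ^ 2 + C (2 * s) * X 1 + C p : P2).totalDegree ≤ 2 := by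
    refine (totalDegree_add _ _).trans (max_le ((totalDegree_add _ _).trans (max_le ?_ ?_)) ?_)
    · simp
    · have := totalDegree_mul (C (2 * s) : P2) (X 1)
      rw [hX, totalDegree_C] at this
      omega
    · simp
  rw [poisson, pderiv_zero_cubicForm, pderiv_one_cubicForm]
  exact (totalDegree_sub _ _).trans
    (max_le (totalDegree_mul_pderiv_le h1 0 a) (totalDegree_mul_pderiv_le h0 1 a))

theorem exists_eq_of_totalDegree_le_one {a : P2} (h : a.totalDegree ≤ 1) :
    ∃ α δ β : ℝ, a = C α * X 0 + C δ * X 1 + C β := by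
  refine ⟨a.coeff (Finsupp.single 0 1), a.coeff (Finsupp.single 1 1), a.coeff 0, ?_⟩
  ext m
  have hsum : (m.sum fun _ e => e) = m 0 + m 1 := by
    rw [Finsupp.sum_fintype _ _ (fun _ => rfl), Fin.sum_univ_two]
  have hm0 : 0 = m ↔ m 0 = 0 ∧ m 1 = 0 := by
    simp [Finsupp.ext_iff, Fin.forall_fin_two, eq_comm]
  have hm1 : Finsupp.single 0 1 = m ↔ m 0 = 1 ∧ m 1 = 0 := by
    simp [Finsupp.ext_iff, Fin.forall_fin_two, eq_comm]
  have hm2 : Finsupp.single 1 1 = m ↔ m 0 = 0 ∧ m 1 = 1 := by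
    simp [Finsupp.ext_iff, Fin.forall_fin_two, eq_comm]
  simp only [coeff_add, coeff_C_mul, coeff_X, coeff_C]
  by_cases hm : 1 < m 0 + m 1
  · have ha : a.coeff m = 0 := coeff_eq_zero_of_totalDegree_lt <| by
      change _ < m.sum fun _ e => e
      omega
    rw [ha, if_neg (by rw [hm1]; omega), if_neg (by rw [hm2]; omega),
      if_neg (by rw [hm0]; omega)]
    ring
  · have : (m 0 = 0 ∧ m 1 = 0) ∨ (m 0 = 1 ∧ m 1 = 0) ∨ (m 0 = 0 ∧ m 1 = 1) := by omega
    rcases this with h | h | h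
    · simp [hm1, hm2, h, hm0.mpr h]
    · simp [hm0, hm2, h, hm1.mpr h]
    · simp [hm0, hm1, h, hm2.mpr h]

section Poisson

variable (s p r J : ℝ)

theorem poisson_cubicForm_X_zero :
    poisson (cubicForm s p r J) (X 0) = X 0 ^ 2 + C (2 * s) * X 1 + C p := by
  simp [poisson, pderiv_zero_cubicForm, pderiv_one_cubicForm, pderiv_X]

theorem poisson_cubicForm_X_one :
    poisson (cubicForm s p r J) (X 1) = C r - C 2 * X 0 * X 1 := by
  simp [poisson, pderiv_zero_cubicForm, pderiv_one_cubicForm, pderiv_X]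

end Poisson

theorem poisson_add_right (a b d : P2) : poisson a (b + d) = poisson a b + poisson a d := by
  simp only [poisson, map_add]; ring

theorem poisson_mul_right (a b d : P2) :
    poisson a (b * d) = poisson a b * d + b * poisson a d := by
  simp only [poisson, pderiv_mul]; ring

theorem poisson_C_right (a : P2) (t : ℝ) : poisson a (C t) = 0 := by
  simp [poisson]

theorem poisson_C_mul_left (a b : P2) (t : ℝ) : poisson (C t * a) b = C t * poisson a b := by
  simp only [poisson, pderiv_C_mul]; ring

/-- An equivalence `φ f = c g` between cubic forms makes `φ x` satisfy the Newton equation of `f`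
along the Hamiltonian flow of `g`, which forces `φ x` to be an affine function of `x`. -/
theorem exists_affine_image {s p r J s' p' r' J' c : ℝ} (φ : P2 ≃+* P2)
    (hφ : φ (cubicForm s p r J) = C c * cubicForm s' p' r' J') :
    ∃ j α β : ℝ, j ≠ 0 ∧ α ≠ 0 ∧ φ (X 0) = C α * X 0 + C β ∧
      (∀ x y : ℝ, c * α * (x ^ 2 + 2 * s' * y + p') =
        j * ((α * x + β) ^ 2 + 2 * s * eval ![x, y] (φ (X 1)) + p)) ∧
      (∀ x : ℝ, c ^ 2 * α * (2 * x ^ 3 + 2 * p' * x + 2 * s' * r') =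
        j ^ 2 * (2 * (α * x + β) ^ 3 + 2 * p * (α * x + β) + 2 * s * r)) := by
  obtain ⟨j, hj, hpoisson⟩ := exists_poisson_ringEquiv φ
  set P := φ (X 0) with hP
  set Q := φ (X 1) with hQ
  set g := cubicForm s' p' r' J'
  have hPdot : C c * poisson g P = C j * (P ^ 2 + C (2 * s) * Q + C p) := by
    rw [← poisson_C_mul_left, ← hφ, hP, hpoisson, poisson_cubicForm_X_zero]
    simp only [map_add, map_mul φ, map_pow, ringEquiv_C_s13, ← hP, ← hQ]
  have hQdot : C c * poisson g Q = C j * (C r - C 2 * P * Q) := by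
    rw [← poisson_C_mul_left, ← hφ, hQ, hpoisson, poisson_cubicForm_X_one]
    simp only [map_sub, map_mul φ, ringEquiv_C_s13, ← hP, ← hQ]
  have hnewton : C (c ^ 2) * poisson g (poisson g P) =
      C (j ^ 2) * (C 2 * P ^ 3 + C (2 * p) * P + C (2 * s * r)) := by
    have h := congrArg (poisson g) hPdot
    simp only [poisson_mul_right, poisson_add_right, poisson_C_right, pow_two] at h
    have h2 : (C 2 : P2) = 2 := map_ofNat C 2
    simp only [C_mul, C_pow, h2] at h hPdot hQdot ⊢
    linear_combination C c * h + 2 * C j * P * hPdot + 2 * C s * C j * hQdot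
  have hdeg : P.totalDegree ≤ 1 := by
    by_contra! hlt
    have hP0 : P ≠ 0 := by rintro h; simp [h] at hlt
    have h3 : (P ^ 3).totalDegree = 3 * P.totalDegree := by
      rw [pow_succ, pow_two, totalDegree_mul_of_isDomain (mul_ne_zero hP0 hP0) hP0,
        totalDegree_mul_of_isDomain hP0 hP0]
      ring
    have hcube : P ^ 3 = C (c ^ 2 / (2 * j ^ 2)) * poisson g (poisson g P)
        - C p * P - C (s * r) := by
      have hk : c ^ 2 / (2 * j ^ 2) = (2 * j ^ 2)⁻¹ * c ^ 2 := by ring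
      have hj2 : (C (2 * j ^ 2)⁻¹ * C (2 * j ^ 2) : P2) = 1 := by
        rw [← C_mul, inv_mul_cancel₀ (by positivity), C_1]
      have h2 : (C 2 : P2) = 2 := map_ofNat C 2
      rw [hk, C_mul, mul_assoc, hnewton]
      simp only [C_mul, C_pow, h2] at hj2 ⊢
      linear_combination -(P ^ 3 + C p * P + C s * C r) * hj2
    have hle : (P ^ 3).totalDegree ≤ P.totalDegree + 2 := by
      rw [hcube]
      refine (totalDegree_sub_C_le _ _).trans ((totalDegree_sub _ _).trans (max_le ?_ ?_))
      · have h1 := totalDegree_poisson_cubicForm_le s' p' r' J' P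
        have h2 := totalDegree_poisson_cubicForm_le s' p' r' J' (poisson g P)
        have h3 := totalDegree_mul (C (c ^ 2 / (2 * j ^ 2)) : P2) (poisson g (poisson g P))
        rw [totalDegree_C] at h3
        change (poisson g P).totalDegree ≤ _ at h1
        change (poisson g (poisson g P)).totalDegree ≤ _ at h2
        omega
      · have h3 := totalDegree_mul (C p : P2) P
        rw [totalDegree_C] at h3
        omega
    omega
  obtain ⟨α, δ, β, hlin⟩ := exists_eq_of_totalDegree_le_one hdeg
  have hgP : poisson g P = C α * (X 0 ^ 2 + C (2 * s') * X 1 + C p')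
      + C δ * (C r' - C 2 * X 0 * X 1) := by
    rw [hlin]
    simp only [g, poisson_add_right, poisson_mul_right, poisson_C_right,
      poisson_cubicForm_X_zero, poisson_cubicForm_X_one]
    ring
  have hggP (x y : ℝ) : eval ![x, y] (poisson g (poisson g P)) =
      α * (2 * x * (x ^ 2 + 2 * s' * y + p') + 2 * s' * (r' - 2 * x * y))
      - 2 * δ * ((x ^ 2 + 2 * s' * y + p') * y + x * (r' - 2 * x * y)) := by
    have hneg : poisson g P = C α * (X 0 * X 0 + C (2 * s') * X 1 + C p')
      + C δ * (C r' + C (-2) * X 0 * X 1) := by rw [hgP, C_neg]; ring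
    rw [hneg]
    simp only [g, poisson_add_right, poisson_mul_right, poisson_C_right,
      poisson_cubicForm_X_zero, poisson_cubicForm_X_one]
    simp
    ring
  have hev (x y : ℝ) := congrArg (eval ![x, y]) hnewton
  simp only [map_mul (eval _), hggP] at hev
  simp only [hlin, map_mul, map_add, map_pow, eval_C, eval_X, Matrix.cons_val_zero,
    Matrix.cons_val_one] at hev
  have hδ : δ = 0 := by
    have : j ^ 2 * δ ^ 3 = 0 := by
      linear_combination (-1 / 12) * (hev 0 2 - 3 * hev 0 1 + 3 * hev 0 0 - hev 0 (-1))
    simpa [hj] using this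
  subst hδ
  have hα : α ≠ 0 := by
    rintro rfl
    have h1 : φ (X 0) = φ (C β) := by rw [ringEquiv_C_s13, ← hP, hlin]; simp
    have h2 := congrArg (eval ![β + 1, 0]) (φ.injective h1)
    simp at h2
  refine ⟨j, α, β, hj, hα, by rw [hlin]; simp, fun x y => ?_, fun x => ?_⟩
  · have h := congrArg (eval ![x, y]) hPdot
    rw [hgP, hlin] at h
    simp only [map_mul, map_add, map_sub, map_pow, eval_C, eval_X, Matrix.cons_val_zero,
      Matrix.cons_val_one] at h
    linear_combination h
  · linear_combination hev x 0

theorem coeff_sq_eq_zero_of_autEquiv {s p r J s' p' r' J' : ℝ}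
    (h : AutEquiv (cubicForm s p r J) (cubicForm s' p' r' J')) (h0 : s = 0) : s' = 0 := by
  obtain ⟨φ, c, hc, hφ⟩ := h
  obtain ⟨j, α, β, hj, hα, hP, h1, h2⟩ := exists_affine_image φ hφ
  subst h0
  have : c * α * s' = 0 := by linear_combination (h1 0 1 - h1 0 0) / 2
  simpa [hc, hα] using this

/-- Equivalent cubic forms differ by a weighted rescaling of their parameters. -/
theorem cubicForm_parameters {s p r J s' p' r' J' : ℝ} (hs : s = 0 ∨ s = 1)
    (hs' : s' = 0 ∨ s' = 1) (h : AutEquiv (cubicForm s p r J) (cubicForm s' p' r' J')) :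
    s = s' ∧ ∃ c α : ℝ, c ≠ 0 ∧ α ≠ 0 ∧ p = α ^ 2 * p' ∧ r * α = c * r' ∧ J = c * J' ∧
      (s = 1 → c = α ^ 4) := by
  have hss : s = s' := by
    have h1 := coeff_sq_eq_zero_of_autEquiv h
    have h2 := coeff_sq_eq_zero_of_autEquiv h.symm
    rcases hs with rfl | rfl <;> rcases hs' with rfl | rfl <;> simp_all
  refine ⟨hss, ?_⟩
  subst hss
  obtain ⟨φ, c, hc, hφ⟩ := h
  obtain ⟨j, α, β, hj, hα, hP, h1, h2⟩ := exists_affine_image φ hφ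
  refine ⟨c, α, hc, hα, ?_⟩
  have hev (x y : ℝ) := congrArg (eval ![x, y]) hφ
  simp only [cubicForm, map_mul, map_add, map_sub, map_pow, ringEquiv_C_s13, hP, eval_C, eval_X,
    Matrix.cons_val_zero, Matrix.cons_val_one] at hev
  rcases hs with rfl | rfl
  · have hcj : c = j * α := by
      have : α * (c - j * α) = 0 := by linear_combination (h1 1 0 + h1 (-1) 0 - 2 * h1 0 0) / 2
      have := (mul_eq_zero.mp this).resolve_left hα
      linear_combination this
    have hβ : β = 0 := by
      have : j * α * β = 0 := by linear_combination -(h1 1 0 - h1 (-1) 0) / 4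
      simpa [hj, hα] using this
    subst hβ
    have hp : p = α ^ 2 * p' := by
      have : j * (p - α ^ 2 * p') = 0 := by rw [hcj] at h1; linear_combination -h1 0 0
      have := (mul_eq_zero.mp this).resolve_left hj
      linear_combination this
    have hprod : (X 0 ^ 2 + C p') * (C (α ^ 2) * φ (X 1) - C c * X 1) =
        C (r * α - c * r') * X 0 + C (c * J' - J) := by
      simp only [cubicForm, map_mul φ, map_add, map_sub, map_pow, ringEquiv_C_s13, hP, hp] at hφ
      simp only [C_mul, C_sub, C_pow, C_0] at hφ ⊢
      linear_combination hφ
    have hzero : C (α ^ 2) * φ (X 1) - C c * X 1 = 0 := by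
      by_contra hne
      have hq : (X 0 ^ 2 + C p' : P2).totalDegree = 2 := by
        rw [totalDegree_add_eq_left_of_totalDegree_lt] <;> simp
      have hq0 : (X 0 ^ 2 + C p' : P2) ≠ 0 := by rintro h; simp [h] at hq
      have hd := congrArg totalDegree hprod
      rw [totalDegree_mul_of_isDomain hq0 hne, hq] at hd
      have h3 := totalDegree_add (C (r * α - c * r') * X 0 : P2) (C (c * J' - J))
      have h4 := totalDegree_mul (C (r * α - c * r') : P2) (X 0)
      rw [totalDegree_C, totalDegree_X] at h4
      rw [totalDegree_C] at h3
      have : max (C (r * α - c * r') * X 0 : P2).totalDegree 0 ≤ 1 := max_le (by omega) (by omega)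
      omega
    rw [hzero, mul_zero] at hprod
    have hx (x : ℝ) := congrArg (eval ![x, 0]) hprod
    simp only [map_zero, map_add, map_mul (eval _), eval_C, eval_X, Matrix.cons_val_zero] at hx
    exact ⟨hp, by linear_combination hx 0 - hx 1, by linear_combination hx 0, by simp⟩
  · have hcj : c ^ 2 = j ^ 2 * α ^ 2 := by
      have : α * (c ^ 2 - j ^ 2 * α ^ 2) = 0 := by
        linear_combination (h2 2 - 3 * h2 1 + 3 * h2 0 - h2 (-1)) / 12
      have := (mul_eq_zero.mp this).resolve_left hα
      linear_combination this
    have hβ : β = 0 := by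
      have : j ^ 2 * α ^ 2 * β = 0 := by
        linear_combination -(h2 1 + h2 (-1) - 2 * h2 0) / 12
      simpa [hj, hα] using this
    subst hβ
    have hp : p = α ^ 2 * p' := by
      have : j ^ 2 * α * (p - α ^ 2 * p') = 0 := by
        linear_combination -(h2 1 - h2 (-1)) / 4 + α * (1 + p') * hcj
      have := (mul_eq_zero.mp this).resolve_left (by positivity)
      linear_combination this
    have hQ (x y : ℝ) : eval ![x, y] (φ (X 1)) =
        c * α / (2 * j) * (x ^ 2 + 2 * y + p') - α ^ 2 * x ^ 2 / 2 - p / 2 := by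
      have := h1 x y
      field_simp
      linear_combination -this
    have hμ : (c * α / (2 * j)) ^ 2 = α ^ 4 / 4 := by
      field_simp
      linear_combination 4 * hcj
    simp only [hQ] at hev
    set μ := c * α / (2 * j)
    have hcα : c = α ^ 4 := by
      linear_combination -(hev 0 1 + hev 0 (-1) - 2 * hev 0 0) / 2 + 4 * hμ
    refine ⟨hp, ?_, ?_, fun _ => hcα⟩
    · linear_combination -(hev 1 0 - hev (-1) 0) / 2
    · subst hp
      linear_combination hev 0 0 - p' ^ 2 * hμ

/-- The parameters occurring in `FamC`. -/
def IsNormalized (s p r J : ℝ) : Prop :=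
  s = 1 ∧ (r = 1 ∨ r = 0 ∧ (p = 1 ∨ p = -1) ∨ r = 0 ∧ p = 0 ∧ (J = 1 ∨ J = -1 ∨ J = 0)) ∨
  s = 0 ∧ (r = 1 ∧ (p = 1 ∨ p = -1) ∧ 0 ≤ J ∨ r = 0 ∧ (p = 1 ∨ p = -1) ∧ (J = 1 ∨ J = 0) ∨
    r = 1 ∧ p = 0 ∧ (J = 1 ∨ J = 0) ∨ r = 0 ∧ p = 0 ∧ (J = -1 ∨ J = 0))

theorem FamC.exists_eq_cubicForm {f : P2} (hf : FamC f) :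
    ∃ s p r J : ℝ, IsNormalized s p r J ∧ f = cubicForm s p r J := by
  rcases hf with ⟨I, J, rfl⟩ | ⟨e, J, he, rfl⟩ | ⟨e, he, rfl⟩ | rfl | ⟨e, J, he, hJ, rfl⟩ |
    ⟨e, he, rfl⟩ | ⟨e, he, rfl⟩ | rfl | rfl | rfl | rfl
  · exact ⟨1, I, 1, J, by simp [IsNormalized], by simp [cubicForm]⟩
  · exact ⟨1, e, 0, J, by simp [IsNormalized, he], by simp [cubicForm]⟩
  · exact ⟨1, 0, 0, e, by rcases he with rfl | rfl <;> simp [IsNormalized], by simp [cubicForm]⟩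
  · exact ⟨1, 0, 0, 0, by simp [IsNormalized], by simp [cubicForm]⟩
  · exact ⟨0, e, 1, J, by simp [IsNormalized, he, hJ], by simp [cubicForm]⟩
  · exact ⟨0, e, 0, 1, by simp [IsNormalized, he], by simp [cubicForm]⟩
  · exact ⟨0, e, 0, 0, by simp [IsNormalized, he], by simp [cubicForm]⟩
  · exact ⟨0, 0, 1, 1, by simp [IsNormalized], by simp [cubicForm]⟩
  · exact ⟨0, 0, 1, 0, by simp [IsNormalized], by simp [cubicForm]⟩
  · exact ⟨0, 0, 0, -1, by simp [IsNormalized], by simp [cubicForm, sub_eq_add_neg]⟩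
  · exact ⟨0, 0, 0, 0, by simp [IsNormalized], by simp [cubicForm]⟩

theorem eq_of_eq_sq_mul {p p' α : ℝ} (hα : α ≠ 0) (hp : p = 1 ∨ p = -1 ∨ p = 0)
    (hp' : p' = 1 ∨ p' = -1 ∨ p' = 0) (h : p = α ^ 2 * p') :
    p = p' ∧ (p ≠ 0 → α ^ 2 = 1) := by
  have : 0 < α ^ 2 := by positivity
  rcases hp with rfl | rfl | rfl <;> rcases hp' with rfl | rfl | rfl <;>
    first
    | exact ⟨rfl, fun _ => by linarith⟩
    | exact ⟨rfl, fun h => absurd rfl h⟩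
    | (exfalso; linarith)

theorem IsNormalized.eq_of_rescaling {s p r J p' r' J' c α : ℝ} (h : IsNormalized s p r J)
    (h' : IsNormalized s p' r' J') (hc : c ≠ 0) (hα : α ≠ 0) (hp : p = α ^ 2 * p')
    (hr : r * α = c * r') (hJ : J = c * J') (hs : s = 1 → c = α ^ 4) :
    p = p' ∧ r = r' ∧ J = J' := by
  have hr01 : r = 1 ∨ r = 0 := by unfold IsNormalized at h; tauto
  have hr01' : r' = 1 ∨ r' = 0 := by unfold IsNormalized at h'; tauto
  have hrr : r = r' := by
    rcases hr01 with rfl | rfl <;> rcases hr01' with rfl | rfl <;> simp_all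
  subst hrr
  have hpp : s = 0 ∨ r = 0 → p = p' ∧ (p ≠ 0 → α ^ 2 = 1) := by
    intro hsr
    refine eq_of_eq_sq_mul hα ?_ ?_ hp
    · rcases h with ⟨rfl, h⟩ | ⟨rfl, h⟩
      · have hr0 : r ≠ 1 := by rcases hsr with h | rfl <;> norm_num at *
        tauto
      · tauto
    · rcases h' with ⟨rfl, h'⟩ | ⟨rfl, h'⟩
      · have hr0 : r ≠ 1 := by rcases hsr with h | rfl <;> norm_num at *
        tauto
      · tauto
  rcases h with ⟨rfl, h⟩ | ⟨rfl, h⟩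
  · replace h' := h'.resolve_right (by simp)
    have hcα := hs rfl
    subst hcα
    rcases hr01 with rfl | rfl
    · have h3 : α ^ 3 = 1 := by
        have : α * (α ^ 3 - 1) = 0 := by linear_combination -hr
        have := (mul_eq_zero.mp this).resolve_left hα
        linear_combination this
      have h1 : α = 1 := by
        have : (α - 1) * (α ^ 2 + α + 1) = 0 := by linear_combination h3
        have := (mul_eq_zero.mp this).resolve_right (by nlinarith [sq_nonneg (α + 1)])
        linear_combination this
      subst h1
      exact ⟨by linear_combination hp, rfl, by linear_combination hJ⟩
    · obtain ⟨rfl, hα2⟩ := hpp (Or.inr rfl)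
      refine ⟨rfl, rfl, ?_⟩
      rcases eq_or_ne p 0 with rfl | hp0
      · have hJ3 : J = 1 ∨ J = -1 ∨ J = 0 := by simpa using h
        have hJ3' : J' = 1 ∨ J' = -1 ∨ J' = 0 := by simpa using h'
        exact (eq_of_eq_sq_mul (α := α ^ 2) (by positivity) hJ3 hJ3'
          (by linear_combination hJ)).1
      · have : α ^ 4 = 1 := by linear_combination (α ^ 2 + 1) * hα2 hp0
        rw [hJ, this, one_mul]
  · replace h' := h'.resolve_left (by simp)
    obtain ⟨rfl, hα2⟩ := hpp (Or.inl rfl)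
    refine ⟨rfl, rfl, ?_⟩
    have hdisj {t : ℝ} (ht : t ≠ 0) (hJt : J = t ∨ J = 0) (hJt' : J' = t ∨ J' = 0) :
        J = J' := by
      have hiff : J = 0 ↔ J' = 0 := by simp [hJ, hc]
      rcases hJt with h1 | h1
      · rw [h1, hJt'.resolve_right (fun h2 => ht (h1.symm.trans (hiff.mpr h2)))]
      · rw [h1, hiff.mp h1]
    rcases hr01 with rfl | rfl
    · rcases eq_or_ne p 0 with rfl | hp0
      · exact hdisj one_ne_zero (by simpa using h) (by simpa using h')
      · have hJ0 : 0 ≤ J := by simp [hp0] at h; exact h.2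
        have hJ0' : 0 ≤ J' := by simp [hp0] at h'; exact h'.2
        have hc2 : c ^ 2 = 1 := by
          have hca : c = α := by linear_combination -hr
          rw [hca, hα2 hp0]
        exact (sq_eq_sq₀ hJ0 hJ0').mp (by rw [hJ, mul_pow, hc2, one_mul])
    · rcases eq_or_ne p 0 with rfl | hp0
      · exact hdisj (neg_ne_zero.mpr one_ne_zero) (by simpa using h) (by simpa using h')
      · exact hdisj one_ne_zero (by simp [hp0] at h; exact h.2)
          (by simp [hp0] at h'; exact h'.2)

theorem stmt13 (f g : P2) (hf : FamC f) (hg : FamC g) (h : AutEquiv f g) :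
    f = g := by
  obtain ⟨s, p, r, J, hn, rfl⟩ := hf.exists_eq_cubicForm
  obtain ⟨s', p', r', J', hn', rfl⟩ := hg.exists_eq_cubicForm
  have hs : s = 0 ∨ s = 1 := by unfold IsNormalized at hn; tauto
  have hs' : s' = 0 ∨ s' = 1 := by unfold IsNormalized at hn'; tauto
  obtain ⟨rfl, c, α, hc, hα, hp, hr, hJ, hcα⟩ := cubicForm_parameters hs hs' h
  obtain ⟨rfl, rfl, rfl⟩ := hn.eq_of_rescaling hn' hc hα hp hr hJ hcα
  rfl
end

section
/- Let K be a field, let f, g ∈ K[x,y], let φ be a ring automorphism of K[x,y] that fixes K, and let c be a nonzero element of K with φ(f) = c·g. Then for every s ∈ K, there exists a point (a,b) ∈ K² with f(a,b) − c·s = 0, ∂f/∂x(a,b) = 0, and ∂f/∂y(a,b) = 0 if and only if there exists a point (a',b') ∈ K² with g(a',b') − s = 0, ∂g/∂x(a',b') = 0, and ∂g/∂y(a',b') = 0. In other words, sing(f) = { c·s : s ∈ sing(g) }. -/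
open MvPolynomial

/-- `Sing h` : the set of `s ∈ K` such that the curve `h - s = 0` has a singular
point in `K²`, i.e. a point where `h - s` and both partial derivatives of `h`
vanish. -/
def Sing {K : Type*} [Field K] (h : MvPolynomial (Fin 2) K) : Set K :=
  {s : K | ∃ a b : K, eval ![a, b] h - s = 0 ∧
    eval ![a, b] (pderiv (0 : Fin 2) h) = 0 ∧
    eval ![a, b] (pderiv (1 : Fin 2) h) = 0}

section ChainRule

variable {R σ : Type*} [CommSemiring R]

/-- Evaluation of `ψ p` is evaluation of `p` at the image point of the polynomial map `ψ`. -/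
theorem eval_algHom_apply {τ : Type*} (ψ : MvPolynomial σ R →ₐ[R] MvPolynomial τ R) (v : τ → R)
    (p : MvPolynomial σ R) :
    eval v (ψ p) = eval (fun j => eval v (ψ (X j))) p := by
  induction p using MvPolynomial.induction_on with
  | C a => simp [← algebraMap_eq]
  | add p q hp hq => simp [hp, hq]
  | mul_X p j hp => simp [hp]

/-- The chain rule for polynomial maps. -/
theorem pderiv_algHom_apply {τ : Type*} [Fintype σ]
    (ψ : MvPolynomial σ R →ₐ[R] MvPolynomial τ R) (i : τ) (p : MvPolynomial σ R) :
    pderiv i (ψ p) = ∑ j, ψ (pderiv j p) * pderiv i (ψ (X j)) := by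
  classical
  induction p using MvPolynomial.induction_on with
  | C a => simp [← algebraMap_eq]
  | add p q hp hq => simp [hp, hq, add_mul, Finset.sum_add_distrib]
  | mul_X p k hp =>
    simp only [map_mul, Derivation.leibniz, smul_eq_mul, hp, map_add, pderiv_X, add_mul,
      Finset.sum_add_distrib, Finset.mul_sum]
    congr 1
    · rw [Finset.sum_eq_single k]
      · simp
      · intro j _ hj
        simp [hj.symm]
      · simp
    · exact Finset.sum_congr rfl fun j _ => by ring

/-- An automorphism of the polynomial ring carries critical points of `p` to critical points of
its image, with the same critical value. -/
theorem exists_critical_algEquiv_apply [Fintype σ]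
    (ψ : MvPolynomial σ R ≃ₐ[R] MvPolynomial σ R) (p : MvPolynomial σ R) (w : σ → R)
    (hw : ∀ j, eval w (pderiv j p) = 0) :
    ∃ v : σ → R, eval v (ψ p) = eval w p ∧ ∀ i, eval v (pderiv i (ψ p)) = 0 := by
  have key (q : MvPolynomial σ R) : eval (fun j => eval w (ψ.symm (X j))) (ψ q) = eval w q := by
    simpa using (eval_algHom_apply ψ.symm.toAlgHom w (ψ q)).symm
  refine ⟨fun j => eval w (ψ.symm (X j)), key p, fun i => ?_⟩
  have h : pderiv i (ψ p) = ∑ j, ψ (pderiv j p) * pderiv i (ψ (X j)) :=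
    pderiv_algHom_apply ψ.toAlgHom i p
  simp [h, key, hw]

end ChainRule

theorem mem_Sing_iff {K : Type*} [Field K] (h : MvPolynomial (Fin 2) K) (s : K) :
    s ∈ Sing h ↔ ∃ v : Fin 2 → K, eval v h = s ∧ ∀ i, eval v (pderiv i h) = 0 := by
  constructor
  · rintro ⟨a, b, h0, h1, h2⟩
    exact ⟨![a, b], sub_eq_zero.mp h0, Fin.forall_fin_two.mpr ⟨h1, h2⟩⟩
  · rintro ⟨v, h0, h1⟩
    have hv : ![v 0, v 1] = v := by
      ext i
      fin_cases i <;> rfl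
    refine ⟨v 0, v 1, ?_⟩
    rw [hv]
    exact ⟨sub_eq_zero.mpr h0, h1 0, h1 1⟩

theorem Sing_algEquiv_apply {K : Type*} [Field K]
    (ψ : MvPolynomial (Fin 2) K ≃ₐ[K] MvPolynomial (Fin 2) K) (h : MvPolynomial (Fin 2) K) :
    Sing (ψ h) = Sing h := by
  ext s
  rw [mem_Sing_iff, mem_Sing_iff]
  constructor
  · rintro ⟨v, rfl, hv⟩
    simpa using exists_critical_algEquiv_apply ψ.symm (ψ h) v hv
  · rintro ⟨v, rfl, hv⟩
    exact exists_critical_algEquiv_apply ψ h v hv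

theorem mul_mem_Sing_C_mul_iff {K : Type*} [Field K] (g : MvPolynomial (Fin 2) K) {c : K}
    (hc : c ≠ 0) (s : K) : c * s ∈ Sing (C c * g) ↔ s ∈ Sing g := by
  simp [mem_Sing_iff, hc]

theorem stmt15 {K : Type*} [Field K] (f g : MvPolynomial (Fin 2) K)
    (φ : MvPolynomial (Fin 2) K ≃+* MvPolynomial (Fin 2) K)
    (hφ : ∀ a : K, φ (C a) = C a) (c : K) (hc : c ≠ 0) (hfg : φ f = C c * g) :
    (∀ s : K,
      ((∃ a b : K, eval ![a, b] f - c * s = 0 ∧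
          eval ![a, b] (pderiv (0 : Fin 2) f) = 0 ∧
          eval ![a, b] (pderiv (1 : Fin 2) f) = 0) ↔
       (∃ a b : K, eval ![a, b] g - s = 0 ∧
          eval ![a, b] (pderiv (0 : Fin 2) g) = 0 ∧
          eval ![a, b] (pderiv (1 : Fin 2) g) = 0))) ∧
    Sing f = (fun s : K => c * s) '' Sing g := by
  have hSing : Sing f = Sing (C c * g) := by
    rw [← hfg]
    exact (Sing_algEquiv_apply (AlgEquiv.ofRingEquiv (f := φ) hφ) f).symm
  have hmem (s : K) : c * s ∈ Sing f ↔ s ∈ Sing g := by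
    rw [hSing, mul_mem_Sing_C_mul_iff g hc]
  refine ⟨hmem, ?_⟩
  ext t
  constructor
  · intro ht
    refine ⟨c⁻¹ * t, (hmem _).mp ?_, mul_inv_cancel_left₀ hc t⟩
    rwa [mul_inv_cancel_left₀ hc]
  · rintro ⟨s, hs, rfl⟩
    exact (hmem s).mpr hs
end
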